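/- arXiv:1806.09053 — 5 statements merged into one kernel-verified Lean document; each statement's English description precedes it below -/
import Mathlib

section
/- Let g, d be positive integers and let A ∈ SM_d(ℝ)^g be such that the real free spectrahedron D_A^ℝ is compact. Then D_A^ℝ is the matrix convex hull of its absolute extreme points; in particular, every X ∈ D_A^ℝ(n) can be written as a finite matrix convex combination X = Σ_{i=1}^m V_i^* Y^i V_i with Σ_i V_i^* V_i = I_n where each Y^i is an absolute extreme point of D_A^ℝ. -/
open Matrix
open scoped Kronecker ComplexOrder

noncomputable section

variable {𝕜 : Type*} [RCLike 𝕜]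

/-- `X` is a `g`-tuple of self-adjoint matrices. -/
def SATuple {g : ℕ} {m : Type*} (X : Fin g → Matrix m m 𝕜) : Prop :=
  ∀ j, (X j).IsHermitian

/-- The homogeneous linear pencil `Λ_A(B) = Σ_j A_j ⊗ B_j` (Kronecker product). -/
def Lam {g d : ℕ} {p q : Type*} (A : Fin g → Matrix (Fin d) (Fin d) 𝕜)
    (B : Fin g → Matrix p q 𝕜) : Matrix (Fin d × p) (Fin d × q) 𝕜 :=
  ∑ j, A j ⊗ₖ B j

/-- The monic linear pencil evaluation `L_A(X) = I + Σ_j A_j ⊗ X_j`. -/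
def LPencil {g d : ℕ} {m : Type*} [Fintype m] [DecidableEq m]
    (A : Fin g → Matrix (Fin d) (Fin d) 𝕜) (X : Fin g → Matrix m m 𝕜) :
    Matrix (Fin d × m) (Fin d × m) 𝕜 :=
  1 + Lam A X

/-- Membership in the free spectrahedron `D_A`: a self-adjoint tuple with `L_A(X) ⪰ 0`. -/
def InSpec {g d : ℕ} {m : Type*} [Fintype m] [DecidableEq m]
    (A : Fin g → Matrix (Fin d) (Fin d) 𝕜) (X : Fin g → Matrix m m 𝕜) : Prop :=
  SATuple X ∧ (LPencil A X).PosSemidef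

/-- Unitary equivalence of tuples (via a two-sided unitary `U`, `U^* X U = Y`). -/
def UEq {g : ℕ} {p q : Type*} [Fintype p] [Fintype q] [DecidableEq p] [DecidableEq q]
    (X : Fin g → Matrix p p 𝕜) (Y : Fin g → Matrix q q 𝕜) : Prop :=
  ∃ U : Matrix p q 𝕜, Uᴴ * U = 1 ∧ U * Uᴴ = 1 ∧ ∀ j, Uᴴ * X j * U = Y j

/-- `X` is an absolute extreme point of the graded matrix convex set `K`: whenever `X` is a
weakly proper matrix convex combination of elements `Y i` of `K`, each `Y i` of size `n` is
unitarily equivalent to `X`, and each `Y i` of size `> n` is unitarily equivalent to a direct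
sum `X ⊕ Z i` with `Z i ∈ K`. -/
def IsAbsExt {g n : ℕ} (K : ∀ ℓ : ℕ, Set (Fin g → Matrix (Fin ℓ) (Fin ℓ) 𝕜))
    (X : Fin g → Matrix (Fin n) (Fin n) 𝕜) : Prop :=
  X ∈ K n ∧
  ∀ (k : ℕ) (nn : Fin k → ℕ) (Y : ∀ i, Fin g → Matrix (Fin (nn i)) (Fin (nn i)) 𝕜)
    (V : ∀ i, Matrix (Fin (nn i)) (Fin n) 𝕜),
    (∀ i, Y i ∈ K (nn i)) → (∀ i, V i ≠ 0) → (∑ i, (V i)ᴴ * V i = 1) →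
    (∀ j, X j = ∑ i, (V i)ᴴ * Y i j * V i) →
    ∀ i, (nn i = n ∧ UEq X (Y i)) ∨
      (n < nn i ∧ ∃ (ℓ : ℕ) (Z : Fin g → Matrix (Fin ℓ) (Fin ℓ) 𝕜), Z ∈ K ℓ ∧
        UEq (fun j => Matrix.fromBlocks (X j) 0 0 (Z j)) (Y i))

set_option linter.unusedSectionVars false

section Spectral

variable {n : Type} [Fintype n] [DecidableEq n]

lemma exists_orthogonal_diagonalization {T : Matrix n n ℝ} (hT : T.IsHermitian) :
    ∃ (U : Matrix n n ℝ) (μ : n → ℝ), Uᵀ * U = 1 ∧ U * Uᵀ = 1 ∧ T = U * diagonal μ * Uᵀ := by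
  have hs : star (hT.eigenvectorUnitary : Matrix n n ℝ)
      = (hT.eigenvectorUnitary : Matrix n n ℝ)ᵀ := by
    rw [star_eq_conjTranspose, conjTranspose_eq_transpose_of_trivial]
  refine ⟨hT.eigenvectorUnitary, hT.eigenvalues, ?_, ?_, ?_⟩
  · rw [← hs]; exact Unitary.coe_star_mul_self _
  · rw [← hs]; exact Unitary.coe_mul_star_self _
  · conv_lhs => rw [hT.spectral_theorem, Unitary.conjStarAlgAut_apply, hs]
    rfl

/-- A positive semidefinite form dominates, up to a constant, every symmetric form whose kernel
contains its kernel. -/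
lemma exists_pos_mul_abs_le {M N : Matrix n n ℝ} (hM : M.PosSemidef) (hN : N.IsHermitian)
    (h : ∀ v, M *ᵥ v = 0 → N *ᵥ v = 0) :
    ∃ t : ℝ, 0 < t ∧ ∀ v, t * |v ⬝ᵥ N *ᵥ v| ≤ v ⬝ᵥ M *ᵥ v := by
  obtain ⟨U, μ, hU, hU', hMU⟩ := exists_orthogonal_diagonalization hM.1
  set N' := Uᵀ * N * U with hN'
  have hNU : N = U * N' * Uᵀ := by
    calc N = (U * Uᵀ) * N * (U * Uᵀ) := by rw [hU']; simp
      _ = _ := by simp only [hN', Matrix.mul_assoc]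
  have hNsymm : ∀ a b, N' a b = N' b a := by
    intro a b
    have hNt : Nᵀ = N := by rw [← conjTranspose_eq_transpose_of_trivial]; exact hN
    have : N'ᵀ = N' := by simp [hN', Matrix.mul_assoc, hNt]
    exact congrFun (congrFun this b) a
  have hzero : ∀ a b, μ b = 0 → N' a b = 0 := by
    intro a b hb
    have h1 : M *ᵥ (U *ᵥ Pi.single b 1) = 0 := by
      rw [hMU, mulVec_mulVec, Matrix.mul_assoc, hU, Matrix.mul_one, ← mulVec_mulVec,
        diagonal_mulVec_single, hb]
      simp
    have h2 := h _ h1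
    have h3 : N' *ᵥ Pi.single b 1 = 0 := by
      rw [hN', Matrix.mul_assoc, ← mulVec_mulVec, ← mulVec_mulVec, h2, mulVec_zero]
    simpa using congrFun h3 a
  have hform : ∀ (B : Matrix n n ℝ) v,
      v ⬝ᵥ (U * B * Uᵀ) *ᵥ v = (Uᵀ *ᵥ v) ⬝ᵥ B *ᵥ (Uᵀ *ᵥ v) := by
    intro B v
    rw [mulVec_transpose, ← dotProduct_mulVec, ← mulVec_transpose, mulVec_mulVec, mulVec_mulVec,
      Matrix.mul_assoc]
  have hμ : ∀ a, 0 ≤ μ a := by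
    intro a
    have h1 := (posSemidef_iff_dotProduct_mulVec.1 hM).2 (U *ᵥ Pi.single a 1)
    rw [star_trivial, hMU, hform, mulVec_mulVec, hU, one_mulVec, diagonal_mulVec_single] at h1
    simpa using h1
  set C := ∑ a, ∑ b, |N' a b| * ((μ a)⁻¹ + (μ b)⁻¹) with hC
  have hC0 : 0 ≤ C := Finset.sum_nonneg fun a _ => Finset.sum_nonneg fun b _ =>
    mul_nonneg (abs_nonneg _) (add_nonneg (inv_nonneg.2 (hμ a)) (inv_nonneg.2 (hμ b)))
  refine ⟨(C + 1)⁻¹, by positivity, fun v => ?_⟩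
  set x := Uᵀ *ᵥ v with hx
  set Q := ∑ a, μ a * x a ^ 2 with hQ
  have hMQ : v ⬝ᵥ M *ᵥ v = Q := by
    rw [hMU, hform, ← hx, hQ]
    simp only [dotProduct, mulVec_diagonal]
    exact Finset.sum_congr rfl fun a _ => by ring
  have hQ0 : 0 ≤ Q := Finset.sum_nonneg fun a _ => mul_nonneg (hμ a) (sq_nonneg _)
  have hle : ∀ a, μ a * x a ^ 2 ≤ Q := fun a =>
    Finset.single_le_sum (f := fun a => μ a * x a ^ 2)
      (fun a _ => mul_nonneg (hμ a) (sq_nonneg _)) (Finset.mem_univ a)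
  have hterm : ∀ a b, |N' a b| * x a ^ 2 ≤ |N' a b| * (μ a)⁻¹ * Q := by
    intro a b
    by_cases ha : μ a = 0
    · rw [hNsymm a b, hzero b a ha]; simp
    · have : |N' a b| * x a ^ 2 = |N' a b| * (μ a)⁻¹ * (μ a * x a ^ 2) := by field_simp
      rw [this]
      exact mul_le_mul_of_nonneg_left (hle a)
        (mul_nonneg (abs_nonneg _) (inv_nonneg.2 (hμ a)))
  have hNQ : |v ⬝ᵥ N *ᵥ v| ≤ C * Q := by
    rw [hNU, hform, ← hx, hC, Finset.sum_mul]
    simp only [dotProduct, mulVec, Finset.mul_sum, Finset.sum_mul]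
    refine (Finset.abs_sum_le_sum_abs _ _).trans (Finset.sum_le_sum fun a _ => ?_)
    refine (Finset.abs_sum_le_sum_abs _ _).trans (Finset.sum_le_sum fun b _ => ?_)
    have h1 := hterm a b
    have h2 := hterm b a
    rw [hNsymm b a] at h2
    have h3 : |x a * (N' a b * x b)| = |N' a b| * (|x a| * |x b|) := by
      rw [abs_mul, abs_mul]; ring
    have h4 : |x a| * |x b| ≤ x a ^ 2 + x b ^ 2 := by
      rw [← sq_abs (x a), ← sq_abs (x b)]
      nlinarith [sq_nonneg (|x a| - |x b|), sq_nonneg |x a|, sq_nonneg |x b|]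
    rw [h3]
    have h5 := mul_le_mul_of_nonneg_left h4 (abs_nonneg (N' a b))
    nlinarith
  rw [hMQ, inv_mul_le_iff₀ (by positivity)]
  nlinarith

/-- A symmetric idempotent factors through an isometry. -/
lemma exists_isometry_of_idempotent {P : Matrix n n ℝ} (hP : P.IsHermitian) (hPP : P * P = P) :
    ∃ (ℓ : ℕ) (V : Matrix n (Fin ℓ) ℝ), Vᵀ * V = 1 ∧ V * Vᵀ = P := by
  obtain ⟨U, μ, hU, hU', hPU⟩ := exists_orthogonal_diagonalization hP
  have hμ : ∀ a, μ a * μ a = μ a := by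
    have h1 : diagonal μ = Uᵀ * P * U := by
      calc diagonal μ = (Uᵀ * U) * diagonal μ * (Uᵀ * U) := by rw [hU]; simp
        _ = _ := by rw [hPU]; simp only [Matrix.mul_assoc]
    have h2 : diagonal μ * diagonal μ = diagonal μ := by
      calc diagonal μ * diagonal μ = Uᵀ * P * (U * Uᵀ) * P * U := by
            rw [h1]; simp only [Matrix.mul_assoc]
        _ = Uᵀ * (P * P) * U := by rw [hU']; simp only [Matrix.mul_assoc, Matrix.mul_one]
        _ = _ := by rw [hPP, h1]
    rw [diagonal_mul_diagonal, diagonal_eq_diagonal_iff] at h2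
    exact h2
  let e := (Fintype.equivFin {a // μ a = 1}).symm
  refine ⟨_, U.submatrix id (fun i => (e i : n)), ?_, ?_⟩
  · ext i k
    have h1 := congrFun (congrFun hU (e i)) (e k)
    simp only [mul_apply, transpose_apply, submatrix_apply, id, one_apply] at h1 ⊢
    rw [h1]
    simp only [Subtype.coe_inj, EmbeddingLike.apply_eq_iff_eq]
  · ext a b
    rw [hPU, mul_apply, mul_apply]
    simp only [transpose_apply, submatrix_apply, id, mul_diagonal]
    rw [e.sum_comp (fun c : {a // μ a = 1} => U a c * U b c),
      ← Finset.sum_subtype (Finset.univ.filter fun a => μ a = 1) (by simp)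
        (fun c => U a c * U b c), Finset.sum_filter]
    refine Finset.sum_congr rfl fun c _ => ?_
    split_ifs with h
    · rw [h, mul_one]
    · have h0 : μ c = 0 := by
        by_contra h0
        exact h (mul_left_cancel₀ h0 (by rw [hμ, mul_one]))
      rw [h0]; ring

end Spectral

section Pencil

variable {g d : ℕ} {A : Fin g → Matrix (Fin d) (Fin d) ℝ}
variable {m : Type} [Fintype m] [DecidableEq m]

/-- The action `W ↦ W + Σ_j A_j W X_j` of the pencil `L_A(X)` (for symmetric `X`) on vectors
written as `d × m` matrices. -/
def pencilMap (A : Fin g → Matrix (Fin d) (Fin d) ℝ) (X : Fin g → Matrix m m ℝ)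
    (W : Matrix (Fin d) m ℝ) : Matrix (Fin d) m ℝ :=
  W + ∑ j, A j * W * X j

lemma lam_mulVec {p q : Type} [Fintype q] (B : Fin g → Matrix p q ℝ)
    (W : Matrix (Fin d) q ℝ) (x : Fin d × p) :
    (Lam A B *ᵥ fun y => W y.1 y.2) x = (∑ j, A j * W * (B j)ᵀ) x.1 x.2 := by
  simp only [Lam, mulVec, dotProduct, Matrix.sum_apply, kroneckerMap_apply, Finset.sum_mul,
    Fintype.sum_prod_type, mul_apply, transpose_apply]
  rw [Finset.sum_congr rfl fun s _ => Finset.sum_comm, Finset.sum_comm]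
  refine Finset.sum_congr rfl fun j _ => ?_
  rw [Finset.sum_comm]
  refine Finset.sum_congr rfl fun b _ => Finset.sum_congr rfl fun s _ => by ring

lemma lPencil_mulVec {X : Fin g → Matrix m m ℝ} (hX : SATuple X) (W : Matrix (Fin d) m ℝ) :
    (LPencil A X *ᵥ fun y => W y.1 y.2) = fun y => pencilMap A X W y.1 y.2 := by
  have hXt : ∀ j, (X j)ᵀ = X j := fun j => by
    rw [← conjTranspose_eq_transpose_of_trivial]; exact hX j
  funext y
  rw [LPencil, add_mulVec, Pi.add_apply, lam_mulVec, one_mulVec, pencilMap, Matrix.add_apply]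
  simp only [hXt]

lemma trace_transpose_mul_eq_dotProduct (W Z : Matrix (Fin d) m ℝ) :
    trace (Wᵀ * Z) = (fun y : Fin d × m => W y.1 y.2) ⬝ᵥ (fun y => Z y.1 y.2) := by
  simp only [trace, diag, mul_apply, transpose_apply, dotProduct, Fintype.sum_prod_type]
  exact Finset.sum_comm

lemma isHermitian_lam (hA : SATuple A) {X : Fin g → Matrix m m ℝ} (hX : SATuple X) :
    (Lam A X).IsHermitian := by
  unfold Lam IsHermitian
  rw [conjTranspose_sum]
  exact Finset.sum_congr rfl fun j _ => by rw [conjTranspose_kronecker, hA j, hX j]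

lemma inSpec_iff (hA : SATuple A) {X : Fin g → Matrix m m ℝ} :
    InSpec A X ↔ SATuple X ∧ ∀ W, 0 ≤ trace (Wᵀ * pencilMap A X W) := by
  unfold InSpec
  refine and_congr_right fun hX => ?_
  rw [posSemidef_iff_dotProduct_mulVec]
  refine ⟨fun h W => ?_, fun h => ⟨isHermitian_one.add (isHermitian_lam hA hX), fun x => ?_⟩⟩
  · have := h.2 fun y => W y.1 y.2
    rwa [lPencil_mulVec hX, star_trivial, ← trace_transpose_mul_eq_dotProduct] at this
  · have := h (of fun s a => x (s, a))
    rw [trace_transpose_mul_eq_dotProduct, ← lPencil_mulVec hX] at this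
    exact this

lemma pencilMap_eq_zero {X : Fin g → Matrix m m ℝ} (h : InSpec A X) {W : Matrix (Fin d) m ℝ}
    (hW : trace (Wᵀ * pencilMap A X W) = 0) : pencilMap A X W = 0 := by
  rw [trace_transpose_mul_eq_dotProduct, ← lPencil_mulVec h.1] at hW
  have := (h.2.dotProduct_mulVec_zero_iff _).1 hW
  rw [lPencil_mulVec h.1] at this
  ext s a
  exact congrFun this (s, a)

/-- Perturbing a point of a free spectrahedron in a direction annihilated by the kernel of the
pencil stays in the free spectrahedron. -/
lemma exists_perturbation (hA : SATuple A) {X S : Fin g → Matrix m m ℝ} (hX : InSpec A X)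
    (hS : SATuple S) (h : ∀ W, pencilMap A X W = 0 → ∑ j, A j * W * S j = 0) :
    ∃ t : ℝ, 0 < t ∧ InSpec A (X + t • S) ∧ InSpec A (X - t • S) := by
  have hSt : ∀ j, (S j)ᵀ = S j := fun j => by
    rw [← conjTranspose_eq_transpose_of_trivial]; exact hS j
  obtain ⟨t, ht, hle⟩ := exists_pos_mul_abs_le hX.2 (isHermitian_lam hA hS) (fun v hv => by
    have h1 : pencilMap A X (of fun s a => v (s, a)) = 0 := by
      ext s a
      have := congrFun (lPencil_mulVec (A := A) hX.1 (of fun s a => v (s, a))) (s, a)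
      exact this.symm.trans (congrFun hv (s, a))
    have h2 := h _ h1
    funext y
    refine (lam_mulVec S (of fun s a => v (s, a)) y).trans ?_
    simp only [hSt, h2]
    rfl)
  have key : ∀ r : ℝ, |r| ≤ t → InSpec A (X + r • S) := by
    intro r hr
    refine ⟨fun j => (hX.1 j).add (by
      show (r • S j)ᴴ = r • S j
      rw [conjTranspose_smul, hS j, star_trivial]), ?_⟩
    have hL : LPencil A (X + r • S) = LPencil A X + r • Lam A S := by
      simp only [LPencil, Lam, Pi.add_apply, Pi.smul_apply, kronecker_add, kronecker_smul,
        Finset.sum_add_distrib, Finset.smul_sum, add_assoc]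
    rw [hL, posSemidef_iff_dotProduct_mulVec]
    refine ⟨hX.2.1.add (by
      show (r • Lam A S)ᴴ = r • Lam A S
      rw [conjTranspose_smul, isHermitian_lam hA hS, star_trivial]), fun v => ?_⟩
    rw [star_trivial, add_mulVec, smul_mulVec, dotProduct_add, dotProduct_smul, smul_eq_mul]
    have h1 := hle v
    have h2 := neg_abs_le (r * (v ⬝ᵥ Lam A S *ᵥ v))
    rw [abs_mul] at h2
    have h3 := mul_le_mul_of_nonneg_right hr (abs_nonneg (v ⬝ᵥ Lam A S *ᵥ v))
    linarith
  refine ⟨t, ht, key t (abs_of_pos ht).le, ?_⟩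
  have := key (-t) (by rw [abs_neg, abs_of_pos ht])
  rwa [neg_smul, ← sub_eq_add_neg] at this

/-- The quadratic form of a matrix convex combination is the sum of the quadratic forms. -/
lemma trace_pencilMap_sum {ι : Type} [Fintype ι] {p : ι → Type} [∀ i, Fintype (p i)]
    [∀ i, DecidableEq (p i)] {X : Fin g → Matrix m m ℝ} {Y : ∀ i, Fin g → Matrix (p i) (p i) ℝ}
    {V : ∀ i, Matrix (p i) m ℝ} (hV : ∑ i, (V i)ᵀ * V i = 1)
    (hX : ∀ j, X j = ∑ i, (V i)ᵀ * Y i j * V i) (W : Matrix (Fin d) m ℝ) :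
    trace (Wᵀ * pencilMap A X W)
      = ∑ i, trace ((W * (V i)ᵀ)ᵀ * pencilMap A (Y i) (W * (V i)ᵀ)) := by
  have h1 : ∀ i, trace ((W * (V i)ᵀ)ᵀ * pencilMap A (Y i) (W * (V i)ᵀ))
      = trace (Wᵀ * (W * ((V i)ᵀ * V i) + ∑ j, A j * W * ((V i)ᵀ * Y i j * V i))) := by
    intro i
    rw [transpose_mul, transpose_transpose, Matrix.mul_assoc, trace_mul_comm, pencilMap]
    simp only [Matrix.mul_add, Matrix.add_mul, Matrix.mul_sum, Matrix.sum_mul, Matrix.mul_assoc]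
  have h2 : pencilMap A X W
      = ∑ i, (W * ((V i)ᵀ * V i) + ∑ j, A j * W * ((V i)ᵀ * Y i j * V i)) := by
    rw [Finset.sum_add_distrib, ← Matrix.mul_sum, hV, Matrix.mul_one, Finset.sum_comm, pencilMap]
    simp only [hX, Matrix.mul_sum]
  rw [Finset.sum_congr rfl fun i _ => h1 i, ← trace_sum, ← Matrix.mul_sum, ← h2]

lemma InSpec.sum (hA : SATuple A) {ι : Type} [Fintype ι] {p : ι → Type} [∀ i, Fintype (p i)]
    [∀ i, DecidableEq (p i)] {X : Fin g → Matrix m m ℝ} {Y : ∀ i, Fin g → Matrix (p i) (p i) ℝ}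
    {V : ∀ i, Matrix (p i) m ℝ} (hV : ∑ i, (V i)ᵀ * V i = 1)
    (hX : ∀ j, X j = ∑ i, (V i)ᵀ * Y i j * V i) (hY : ∀ i, InSpec A (Y i)) : InSpec A X := by
  rw [inSpec_iff hA]
  refine ⟨fun j => ?_, fun W => ?_⟩
  · unfold IsHermitian
    rw [hX, conjTranspose_sum]
    refine Finset.sum_congr rfl fun i _ => ?_
    rw [conjTranspose_mul, conjTranspose_mul, (hY i).1 j, conjTranspose_eq_transpose_of_trivial,
      conjTranspose_eq_transpose_of_trivial, transpose_transpose, Matrix.mul_assoc]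
  · rw [trace_pencilMap_sum hV hX]
    exact Finset.sum_nonneg fun i _ => ((inSpec_iff hA).1 (hY i)).2 _

variable {p : Type} [Fintype p] [DecidableEq p]

lemma InSpec.compress (hA : SATuple A) {Y : Fin g → Matrix p p ℝ} (hY : InSpec A Y)
    {V : Matrix p m ℝ} (hV : Vᵀ * V = 1) : InSpec A fun j => Vᵀ * Y j * V :=
  InSpec.sum hA (ι := Unit) (p := fun _ => p) (Y := fun _ => Y) (V := fun _ => V)
    (by simpa using hV) (by simp) fun _ => hY

/-- The dilation subspace: directions `β` with `ker L_A(X) ⊆ ker Λ_A(β^*)`. -/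
def dilationSubspace (A : Fin g → Matrix (Fin d) (Fin d) ℝ) (X : Fin g → Matrix m m ℝ) :
    Submodule ℝ (Fin g → m → ℝ) where
  carrier := {β | ∀ W, pencilMap A X W = 0 → ∑ j, A j *ᵥ (W *ᵥ β j) = 0}
  add_mem' {a b} ha hb W hW := by
    simp only [Pi.add_apply, mulVec_add, Finset.sum_add_distrib, ha W hW, hb W hW, add_zero]
  zero_mem' W _ := by simp
  smul_mem' c a ha W hW := by
    simp only [Pi.smul_apply, mulVec_smul, ← Finset.smul_sum, ha W hW, smul_zero]

lemma transpose_mulVec_mem_dilationSubspace {Y : Fin g → Matrix p p ℝ} (hY : InSpec A Y)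
    {V : Matrix p m ℝ} (hV : Vᵀ * V = 1) {β : Fin g → p → ℝ} (hβ : β ∈ dilationSubspace A Y) :
    (fun j => Vᵀ *ᵥ β j) ∈ dilationSubspace A fun j => Vᵀ * Y j * V := by
  intro W hW
  have h1 := trace_pencilMap_sum (A := A) (ι := Unit) (p := fun _ => p) (Y := fun _ => Y)
    (V := fun _ => V) (X := fun j => Vᵀ * Y j * V) (by simpa using hV) (by simp) W
  rw [hW, Matrix.mul_zero, trace_zero, Fintype.sum_unique] at h1
  have h2 := hβ _ (pencilMap_eq_zero hY h1.symm)
  simpa only [mulVec_mulVec, Matrix.mul_assoc] using h2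

/-- If `V` intertwines `X` and `Y`, it maps the dilation subspace of `X` into that of `Y`. -/
lemma mulVec_mem_dilationSubspace {Y : Fin g → Matrix p p ℝ} {X : Fin g → Matrix m m ℝ}
    {V : Matrix p m ℝ} (hV : ∀ j, Y j * V = V * X j) {β : Fin g → m → ℝ}
    (hβ : β ∈ dilationSubspace A X) : (fun j => V *ᵥ β j) ∈ dilationSubspace A Y := by
  intro W hW
  have h1 : pencilMap A X (W * V) = pencilMap A Y W * V := by
    simp only [pencilMap, Matrix.add_mul, Matrix.sum_mul, Matrix.mul_assoc, hV]
  rw [hW, Matrix.zero_mul] at h1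
  simpa only [mulVec_mulVec, Matrix.mul_assoc] using hβ _ h1

end Pencil

section Dilation

variable {g d : ℕ} {A : Fin g → Matrix (Fin d) (Fin d) ℝ}
variable {m : Type} [Fintype m] [DecidableEq m]

/-- The `1`-dilation of the tuple `X` with off-diagonal part `β` and corner `γ`. -/
def oneDilation (X : Fin g → Matrix m m ℝ) (β : Fin g → m → ℝ) (γ : Fin g → ℝ) :
    Fin g → Matrix (m ⊕ Unit) (m ⊕ Unit) ℝ :=
  fun j => fromBlocks (X j) (replicateCol Unit (β j)) (replicateRow Unit (β j)) (of fun _ _ => γ j)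

lemma saTuple_oneDilation {X : Fin g → Matrix m m ℝ} (hX : SATuple X) (β : Fin g → m → ℝ)
    (γ : Fin g → ℝ) : SATuple (oneDilation X β γ) := by
  intro j
  refine IsHermitian.fromBlocks (hX j) ?_ ?_
  · ext a b; simp
  · ext a b; simp

lemma sum_mul_fromCols_mul_fromBlocks (W : Matrix (Fin d) m ℝ) (w : Matrix (Fin d) Unit ℝ)
    (X : Fin g → Matrix m m ℝ) (B : Fin g → Matrix m Unit ℝ) (C : Fin g → Matrix Unit m ℝ)
    (D : Fin g → Matrix Unit Unit ℝ) :
    ∑ j, A j * fromCols W w * fromBlocks (X j) (B j) (C j) (D j)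
      = fromCols (∑ j, (A j * W * X j + A j * w * C j)) (∑ j, (A j * W * B j + A j * w * D j)) := by
  simp only [mul_fromCols, fromCols_mul_fromBlocks]
  ext s (a | a) <;> simp [Matrix.sum_apply]

lemma pencilMap_oneDilation_zero (X : Fin g → Matrix m m ℝ) (W : Matrix (Fin d) m ℝ)
    (w : Matrix (Fin d) Unit ℝ) :
    pencilMap A (oneDilation X 0 0) (fromCols W w) = fromCols (pencilMap A X W) w := by
  have h0 : replicateCol Unit (0 : m → ℝ) = 0 := rfl
  have h1 : replicateRow Unit (0 : m → ℝ) = 0 := rfl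
  have h2 : (of fun _ _ => 0 : Matrix Unit Unit ℝ) = 0 := rfl
  simp only [pencilMap, oneDilation, sum_mul_fromCols_mul_fromBlocks, Pi.zero_apply, h0, h1, h2]
  ext s (a | a) <;> simp

lemma inSpec_oneDilation_zero (hA : SATuple A) {X : Fin g → Matrix m m ℝ} (hX : InSpec A X) :
    InSpec A (oneDilation X 0 0) := by
  rw [inSpec_iff hA] at hX ⊢
  refine ⟨saTuple_oneDilation hX.1 _ _, fun W => ?_⟩
  rw [← fromCols_toCols W, pencilMap_oneDilation_zero, transpose_fromCols, fromRows_mul_fromCols,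
    trace, Fintype.sum_sum_type]
  refine add_nonneg (hX.2 _) ?_
  change 0 ≤ trace (W.toCols₂ᵀ * W.toCols₂)
  rw [trace_transpose_mul_eq_dotProduct]
  exact Finset.sum_nonneg fun _ _ => mul_self_nonneg _

lemma exists_oneDilation (hA : SATuple A) {X : Fin g → Matrix m m ℝ} (hX : InSpec A X)
    {β : Fin g → m → ℝ} (hβ : β ∈ dilationSubspace A X) :
    ∃ c : ℝ, 0 < c ∧ InSpec A (oneDilation X (c • β) 0) := by
  obtain ⟨c, hc, h, -⟩ := exists_perturbation hA (inSpec_oneDilation_zero hA hX)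
    (saTuple_oneDilation (X := (0 : Fin g → Matrix m m ℝ)) (fun _ => isHermitian_zero) β 0)
    (fun W hW => by
      rw [← fromCols_toCols W, pencilMap_oneDilation_zero] at hW
      have h1 : pencilMap A X W.toCols₁ = 0 := by
        ext s a; exact congrFun (congrFun hW s) (Sum.inl a)
      have h2 : W.toCols₂ = 0 := by
        ext s a; exact congrFun (congrFun hW s) (Sum.inr a)
      have h3 := hβ _ h1
      rw [← fromCols_toCols W, h2]
      simp only [oneDilation, sum_mul_fromCols_mul_fromBlocks]
      ext s (a | a)
      · simp
      · have h4 := congrFun h3 s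
        simp only [Finset.sum_apply, mulVec_mulVec] at h4
        simpa [Matrix.sum_apply, mul_apply, mulVec, dotProduct] using h4)
  refine ⟨c, hc, ?_⟩
  convert h using 1
  funext j
  ext (a | a) (b | b) <;> simp [oneDilation]

lemma isClosed_inSpec (hA : SATuple A) :
    IsClosed {X : Fin g → Matrix m m ℝ | InSpec A X} := by
  simp only [inSpec_iff hA, SATuple, IsHermitian, Set.ofPred_and, Set.ofPred_forall]
  refine (isClosed_iInter fun j => isClosed_eq ?_ ?_).inter
    (isClosed_iInter fun W => isClosed_le continuous_const ?_)
  · fun_prop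
  · fun_prop
  · unfold pencilMap
    fun_prop

variable {C : ℝ}

lemma sq_apply_le (hA : SATuple A) (hC : ∀ (m : ℕ) (X : Fin g → Matrix (Fin m) (Fin m) ℝ),
      InSpec A X → (C • (1 : Matrix (Fin m) (Fin m) ℝ) - ∑ j, X j * X j).PosSemidef)
    {X : Fin g → Matrix m m ℝ} (hX : InSpec A X) (j : Fin g) (a b : m) : X j a b ^ 2 ≤ C := by
  let e := Fintype.equivFin m
  have hV : ((1 : Matrix m m ℝ).submatrix id e.symm)ᵀ * (1 : Matrix m m ℝ).submatrix id e.symm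
      = 1 := by
    ext i k
    simp [mul_apply, one_apply]
  have h2 : (fun j => ((1 : Matrix m m ℝ).submatrix id e.symm)ᵀ * X j *
      (1 : Matrix m m ℝ).submatrix id e.symm) = fun j => (X j).submatrix e.symm e.symm := by
    funext j
    ext i k
    simp [mul_apply, one_apply]
  have h1 := hX.compress hA hV
  rw [h2] at h1
  replace h1 := (hC _ _ h1).diag_nonneg (i := e a)
  have hsymm : ∀ j a b, X j a b = X j b a := fun j a b => by
    have := congrFun (congrFun (hX.1 j) b) a
    simpa using this
  simp only [Matrix.sub_apply, Matrix.smul_apply, one_apply_eq, smul_eq_mul, mul_one,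
    Matrix.sum_apply, mul_apply, submatrix_apply, Equiv.symm_apply_apply] at h1
  have h3 : X j a b ^ 2 ≤ ∑ j, ∑ k, X j a (e.symm k) * X j (e.symm k) a := by
    refine le_trans ?_ (Finset.single_le_sum (f := fun j => ∑ k, X j a (e.symm k) * X j (e.symm k) a)
      (fun j _ => Finset.sum_nonneg fun k _ => ?_) (Finset.mem_univ j))
    · refine le_trans (le_of_eq ?_) (Finset.single_le_sum
        (f := fun k => X j a (e.symm k) * X j (e.symm k) a) (fun k _ => ?_) (Finset.mem_univ (e b)))
      · simp only [Equiv.symm_apply_apply]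
        rw [hsymm j b a, sq]
      · simp only [hsymm j (e.symm k) a]
        exact mul_self_nonneg _
    · rw [hsymm j (e.symm k) a]
      exact mul_self_nonneg _
  linarith

/-- Existence of maximal `1`-dilations in a nonzero direction. -/
lemma exists_maximal_oneDilation (hA : SATuple A)
    (hC : ∀ (m : ℕ) (X : Fin g → Matrix (Fin m) (Fin m) ℝ),
      InSpec A X → (C • (1 : Matrix (Fin m) (Fin m) ℝ) - ∑ j, X j * X j).PosSemidef)
    {X : Fin g → Matrix m m ℝ} (hX : InSpec A X) {β : Fin g → m → ℝ} (hβ : β ≠ 0) :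
    ∃ (α : ℝ) (γ : Fin g → ℝ), InSpec A (oneDilation X (α • β) γ) ∧
      (∀ α' γ', InSpec A (oneDilation X (α' • β) γ') → α' ≤ α) ∧
      (∀ γ', InSpec A (oneDilation X (α • β) γ') → ∑ j, γ' j ^ 2 ≤ ∑ j, γ j ^ 2) := by
  obtain ⟨j₀, a₀, h₀⟩ : ∃ j a, β j a ≠ 0 := by
    by_contra! h
    exact hβ (funext fun j => funext fun a => h j a)
  let F : Set (ℝ × (Fin g → ℝ)) := {z | InSpec A (oneDilation X (z.1 • β) z.2)}
  have hFc : IsClosed F := by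
    refine (isClosed_inSpec hA).preimage (f := fun z : ℝ × (Fin g → ℝ) =>
      oneDilation X (z.1 • β) z.2) (continuous_pi fun j => ?_)
    refine Continuous.matrix_fromBlocks continuous_const ?_ ?_ ?_ <;>
    · refine continuous_pi fun a => continuous_pi fun b => ?_
      simp only [replicateCol_apply, replicateRow_apply, of_apply, Pi.smul_apply]
      fun_prop
  have hFb : Bornology.IsBounded F := by
    refine isBounded_iff_forall_norm_le.2 ⟨max (√C / |β j₀ a₀|) √C, fun z hz => ?_⟩
    refine norm_prod_le_iff.2 ⟨le_max_of_le_left ?_, le_max_of_le_right ?_⟩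
    · have := Real.abs_le_sqrt (sq_apply_le hA hC hz j₀ (Sum.inl a₀) (Sum.inr ()))
      rw [le_div_iff₀ (abs_pos.2 h₀), Real.norm_eq_abs, ← abs_mul]
      simpa [oneDilation] using this
    · refine (pi_norm_le_iff_of_nonneg (Real.sqrt_nonneg C)).2 fun j => ?_
      have := Real.abs_le_sqrt (sq_apply_le hA hC hz j (Sum.inr ()) (Sum.inr ()))
      simpa [oneDilation] using this
  have hF : IsCompact F := Metric.isCompact_of_isClosed_isBounded hFc hFb
  have hFne : F.Nonempty := by
    refine ⟨(0, 0), ?_⟩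
    show InSpec A (oneDilation X ((0 : ℝ) • β) 0)
    rw [zero_smul]
    exact inSpec_oneDilation_zero hA hX
  obtain ⟨z, hz, hzmax⟩ := hF.exists_isMaxOn hFne (f := Prod.fst) continuous_fst.continuousOn
  have hG : IsCompact (F ∩ {y | y.1 = z.1}) :=
    hF.inter_right (isClosed_eq continuous_fst continuous_const)
  obtain ⟨y, hy, hymax⟩ := hG.exists_isMaxOn ⟨z, hz, rfl⟩
    (f := fun y => ∑ j, y.2 j ^ 2) (by fun_prop)
  refine ⟨y.1, y.2, hy.1, fun α' γ' h => ?_, fun γ' h => ?_⟩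
  · rw [hy.2]; exact hzmax (a := (α', γ')) h
  · exact hymax (a := (y.1, γ')) ⟨h, hy.2⟩

lemma corner_eq_zero (hA : SATuple A) {X : Fin g → Matrix m m ℝ} {β : Fin g → m → ℝ}
    {γ : Fin g → ℝ} (h : InSpec A (oneDilation X β γ))
    (hmax : ∀ γ', InSpec A (oneDilation X β γ') → ∑ j, γ' j ^ 2 ≤ ∑ j, γ j ^ 2)
    {η : Fin g → m ⊕ Unit → ℝ} (hη : η ∈ dilationSubspace A (oneDilation X β γ))
    (hη0 : ∀ j a, η j (Sum.inl a) = 0) : η = 0 := by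
  obtain ⟨t, ht, h1, h2⟩ := exists_perturbation hA h
    (saTuple_oneDilation (X := (0 : Fin g → Matrix m m ℝ)) (fun _ => isHermitian_zero) 0
      fun j => η j (Sum.inr ()))
    (fun W hW => by
      have h3 := hη _ hW
      ext s (a | a)
      · simp [oneDilation, Matrix.sum_apply, mul_apply]
      · have h4 := congrFun h3 s
        simp only [Finset.sum_apply, mulVec_mulVec] at h4
        simpa [Matrix.sum_apply, mul_apply, mulVec, dotProduct, oneDilation, hη0] using h4)
  have e1 : oneDilation X β γ + t • oneDilation 0 0 (fun j => η j (Sum.inr ()))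
      = oneDilation X β (fun j => γ j + t * η j (Sum.inr ())) := by
    funext j; ext (a | a) (b | b) <;> simp [oneDilation]
  have e2 : oneDilation X β γ - t • oneDilation 0 0 (fun j => η j (Sum.inr ()))
      = oneDilation X β (fun j => γ j - t * η j (Sum.inr ())) := by
    funext j; ext (a | a) (b | b) <;> simp [oneDilation]
  rw [e1] at h1
  rw [e2] at h2
  have h3 := add_le_add (hmax _ h1) (hmax _ h2)
  have h4 : ∑ j, (γ j + t * η j (Sum.inr ())) ^ 2 + ∑ j, (γ j - t * η j (Sum.inr ())) ^ 2
      = ∑ j, γ j ^ 2 + ∑ j, γ j ^ 2 + 2 * t ^ 2 * ∑ j, η j (Sum.inr ()) ^ 2 := by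
    rw [Finset.mul_sum, ← Finset.sum_add_distrib, ← Finset.sum_add_distrib,
      ← Finset.sum_add_distrib]
    exact Finset.sum_congr rfl fun j _ => by ring
  have h5 : ∑ j, η j (Sum.inr ()) ^ 2 = 0 := by
    refine le_antisymm ?_ (Finset.sum_nonneg fun j _ => sq_nonneg _)
    have : 0 < 2 * t ^ 2 := by positivity
    nlinarith
  rw [Finset.sum_eq_zero_iff_of_nonneg fun j _ => sq_nonneg _] at h5
  funext j
  ext (a | a)
  · exact hη0 j a
  · exact pow_eq_zero_iff two_ne_zero |>.1 (h5 j (Finset.mem_univ j))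

lemma not_extends_direction (hA : SATuple A) {X : Fin g → Matrix m m ℝ} {β : Fin g → m → ℝ}
    {α : ℝ} {γ : Fin g → ℝ} (h : InSpec A (oneDilation X (α • β) γ))
    (hmax : ∀ α' γ', InSpec A (oneDilation X (α' • β) γ') → α' ≤ α)
    {η : Fin g → m ⊕ Unit → ℝ} (hη : η ∈ dilationSubspace A (oneDilation X (α • β) γ))
    (hηβ : ∀ j a, η j (Sum.inl a) = β j a) : False := by
  obtain ⟨c, hc, hZ⟩ := exists_oneDilation hA h hη
  set r := √(α ^ 2 + c ^ 2) with hr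
  have hr2 : r ^ 2 = α ^ 2 + c ^ 2 := Real.sq_sqrt (by positivity)
  have hr0 : 0 < r := Real.sqrt_pos.2 (by positivity)
  let V : Matrix ((m ⊕ Unit) ⊕ Unit) (m ⊕ Unit) ℝ :=
    fromRows (fromBlocks 1 0 0 (of fun _ _ => α / r)) (fromCols 0 (of fun _ _ => c / r))
  have hV : Vᵀ * V = 1 := by
    ext (a | a) (b | b)
    · simp [V, mul_apply, one_apply, eq_comm]
    · simp [V, mul_apply, one_apply]
    · simp [V, mul_apply, one_apply]
    · simp [V, mul_apply, one_apply]
      field_simp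
      linarith
  have h1 := hZ.compress hA hV
  refine absurd (hmax r (fun j => (Vᵀ * oneDilation (oneDilation X (α • β) γ) (c • η) 0 j * V)
    (Sum.inr ()) (Sum.inr ())) ?_) (not_le.2 ?_)
  · convert h1 using 1
    funext j
    ext (a | a) (b | b)
    · simp [V, oneDilation, mul_apply, one_apply]
    · simp [V, oneDilation, mul_apply, one_apply, hηβ]
      field_simp
      rw [hr2]; ring
    · simp [V, oneDilation, mul_apply, one_apply, hηβ]
      field_simp
      rw [hr2]; ring
    · simp [oneDilation]
  · nlinarith [sq_nonneg c, pow_pos hc 2]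

/-- A point with nonzero dilation subspace dilates to a point whose dilation subspace has smaller
dimension. -/
lemma exists_dilation_finrank_lt (hA : SATuple A)
    (hC : ∀ (m : ℕ) (X : Fin g → Matrix (Fin m) (Fin m) ℝ),
      InSpec A X → (C • (1 : Matrix (Fin m) (Fin m) ℝ) - ∑ j, X j * X j).PosSemidef)
    {X : Fin g → Matrix m m ℝ} (hX : InSpec A X) (hne : dilationSubspace A X ≠ ⊥) :
    ∃ (Y : Fin g → Matrix (m ⊕ Unit) (m ⊕ Unit) ℝ) (V : Matrix (m ⊕ Unit) m ℝ),
      InSpec A Y ∧ Vᵀ * V = 1 ∧ (∀ j, X j = Vᵀ * Y j * V) ∧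
      Module.finrank ℝ (dilationSubspace A Y) < Module.finrank ℝ (dilationSubspace A X) := by
  obtain ⟨β, hβ, hβ0⟩ := Submodule.exists_mem_ne_zero_of_ne_bot hne
  obtain ⟨α, γ, hY, hα, hγ⟩ := exists_maximal_oneDilation hA hC hX hβ0
  let V : Matrix (m ⊕ Unit) m ℝ := fromRows 1 0
  have hV : Vᵀ * V = 1 := by ext a b; simp [V, mul_apply, one_apply, eq_comm]
  have hXV : ∀ j, X j = Vᵀ * oneDilation X (α • β) γ j * V := by
    intro j; ext a b; simp [V, mul_apply, one_apply, oneDilation]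
  have hVη : ∀ η : m ⊕ Unit → ℝ, Vᵀ *ᵥ η = fun a => η (Sum.inl a) := by
    intro η; ext a; simp [V, mulVec, dotProduct, one_apply]
  refine ⟨_, V, hY, hV, hXV, ?_⟩
  let π : (Fin g → m ⊕ Unit → ℝ) →ₗ[ℝ] (Fin g → m → ℝ) :=
    { toFun := fun η j a => η j (Sum.inl a)
      map_add' := fun _ _ => rfl
      map_smul' := fun _ _ => rfl }
  set K := dilationSubspace A (oneDilation X (α • β) γ) with hK
  have hinj : Function.Injective (π.domRestrict K) := by
    rw [injective_iff_map_eq_zero]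
    rintro ⟨η, hη⟩ h0
    exact Subtype.ext (corner_eq_zero hA hY hγ hη fun j a => congrFun (congrFun h0 j) a)
  rw [← LinearMap.finrank_range_of_inj hinj]
  refine Submodule.finrank_lt_finrank_of_lt (lt_of_le_of_ne ?_ ?_)
  · rintro _ ⟨⟨η, hη⟩, rfl⟩
    have := transpose_mulVec_mem_dilationSubspace hY hV hη
    simp only [hVη, ← hXV] at this
    exact this
  · intro heq
    rw [← heq] at hβ
    obtain ⟨⟨η, hη⟩, hηβ⟩ := hβ
    exact not_extends_direction hA hY hα hη fun j a => congrFun (congrFun hηβ j) a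

end Dilation

section Hull

variable {g d : ℕ} {A : Fin g → Matrix (Fin d) (Fin d) ℝ}

/-- The only symmetric matrices commuting with the tuple are the scalars. -/
def HasScalarCommutant {m : Type} [Fintype m] [DecidableEq m] (X : Fin g → Matrix m m ℝ) : Prop :=
  ∀ T : Matrix m m ℝ, T.IsHermitian → (∀ j, T * X j = X j * T) → ∃ c : ℝ, T = c • 1

/-- Points of the free spectrahedron with trivial dilation subspace only admit trivial
representations as matrix convex combinations. -/
lemma intertwines_of_dilationSubspace_eq_bot (hA : SATuple A) {m : Type} [Fintype m]
    [DecidableEq m] {ι : Type} [Fintype ι] {p : ι → Type} [∀ i, Fintype (p i)]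
    [∀ i, DecidableEq (p i)] {X : Fin g → Matrix m m ℝ} {Y : ∀ i, Fin g → Matrix (p i) (p i) ℝ}
    {V : ∀ i, Matrix (p i) m ℝ} (hbot : dilationSubspace A X = ⊥)
    (hV : ∑ i, (V i)ᵀ * V i = 1) (hX : ∀ j, X j = ∑ i, (V i)ᵀ * Y i j * V i)
    (hY : ∀ i, InSpec A (Y i)) (i : ι) (j : Fin g) : Y i j * V i = V i * X j := by
  have hXs := (InSpec.sum hA hV hX hY).1
  have hXt : ∀ j, (X j)ᵀ = X j := fun j => by
    rw [← conjTranspose_eq_transpose_of_trivial]; exact hXs j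
  have hYt : ∀ j, (Y i j)ᵀ = Y i j := fun j => by
    rw [← conjTranspose_eq_transpose_of_trivial]; exact (hY i).1 j
  have hrow : ∀ a, (fun j => (Y i j * V i - V i * X j) a) ∈ dilationSubspace A X := by
    intro a W hW
    have h1 := trace_pencilMap_sum (A := A) hV hX W
    rw [hW, Matrix.mul_zero, trace_zero, eq_comm, Finset.sum_eq_zero_iff_of_nonneg
      fun i _ => ((inSpec_iff hA).1 (hY i)).2 _] at h1
    have h2 := pencilMap_eq_zero (hY i) (h1 i (Finset.mem_univ i))
    have h3 : ∑ j, A j * W * (Y i j * V i - V i * X j)ᵀ = 0 := by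
      have h4 : ∑ j, A j * W * (Y i j * V i - V i * X j)ᵀ
          = pencilMap A (Y i) (W * (V i)ᵀ) - pencilMap A X W * (V i)ᵀ := by
        simp only [pencilMap, transpose_sub, transpose_mul, hXt, hYt, Matrix.mul_sub,
          Finset.sum_sub_distrib, Matrix.add_mul, Matrix.sum_mul, Matrix.mul_assoc]
        abel
      rw [h4, h2, hW, Matrix.zero_mul, sub_zero]
    ext s
    have h5 := congrFun (congrFun h3 s) a
    simp only [Matrix.sum_apply, Finset.sum_apply, mulVec_mulVec, mul_apply, transpose_apply,
      mulVec, dotProduct, Matrix.zero_apply, Pi.zero_apply] at h5 ⊢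
    exact h5
  simp only [hbot, Submodule.mem_bot] at hrow
  rw [← sub_eq_zero]
  ext a b
  exact congrFun (congrFun (hrow a) j) b

lemma isAbsExt_of_dilationSubspace_eq_bot (hA : SATuple A) {n : ℕ}
    {X : Fin g → Matrix (Fin n) (Fin n) ℝ} (hX : InSpec A X) (hbot : dilationSubspace A X = ⊥)
    (hirr : HasScalarCommutant X) :
    IsAbsExt (fun ℓ => {W : Fin g → Matrix (Fin ℓ) (Fin ℓ) ℝ | InSpec A W}) X := by
  refine ⟨hX, fun k nn Y V hY hV0 hV hXV i => ?_⟩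
  simp only [conjTranspose_eq_transpose_of_trivial] at hV hXV
  have hint := intertwines_of_dilationSubspace_eq_bot hA hbot hV hXV hY i
  have hXt : ∀ j, (X j)ᵀ = X j := fun j => by
    rw [← conjTranspose_eq_transpose_of_trivial]; exact hX.1 j
  have hYt : ∀ j, (Y i j)ᵀ = Y i j := fun j => by
    rw [← conjTranspose_eq_transpose_of_trivial]; exact (hY i).1 j
  have hint' : ∀ j, (V i)ᵀ * Y i j = X j * (V i)ᵀ := fun j => by
    simpa [hXt, hYt] using congrArg transpose (hint j)
  obtain ⟨c, hc⟩ := hirr ((V i)ᵀ * V i) (by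
    rw [← conjTranspose_eq_transpose_of_trivial]; exact isHermitian_conjTranspose_mul_self _)
    (fun j => by rw [Matrix.mul_assoc, ← hint, ← Matrix.mul_assoc, hint', Matrix.mul_assoc])
  have hc0 : 0 < c := by
    obtain ⟨a, b, hab⟩ : ∃ a b, V i a b ≠ 0 := by
      by_contra! h
      exact hV0 i (by ext a b; exact h a b)
    have h1 := congrFun (congrFun hc b) b
    simp only [mul_apply, transpose_apply, Matrix.smul_apply, one_apply_eq, smul_eq_mul,
      mul_one] at h1
    rw [← h1]
    exact Finset.sum_pos' (fun _ _ => mul_self_nonneg _)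
      ⟨a, Finset.mem_univ a, mul_self_pos.2 hab⟩
  set U := (√c)⁻¹ • V i with hU
  have hUU : Uᵀ * U = 1 := by
    have : (√c)⁻¹ * (√c)⁻¹ * c = 1 := by
      have h1 : √c ≠ 0 := (Real.sqrt_pos.2 hc0).ne'
      field_simp
      exact (Real.sq_sqrt hc0.le).symm
    rw [hU, transpose_smul, Matrix.smul_mul, Matrix.mul_smul, hc, smul_smul, smul_smul, this,
      one_smul]
  have hUint : ∀ j, Y i j * U = U * X j := fun j => by
    rw [hU, Matrix.mul_smul, hint, Matrix.smul_mul]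
  have hUint' : ∀ j, Uᵀ * Y i j = X j * Uᵀ := fun j => by
    rw [hU, transpose_smul, Matrix.smul_mul, hint', Matrix.mul_smul]
  have hle : n ≤ nn i := by
    have h1 : Function.Injective U.mulVecLin := by
      intro x y hxy
      have := congrArg (fun z => Uᵀ *ᵥ z) hxy
      simpa [mulVec_mulVec, hUU] using this
    simpa using LinearMap.finrank_le_finrank_of_injective h1
  rcases hle.eq_or_lt with heq | hlt
  · refine Or.inl ⟨heq.symm, Uᵀ, ?_⟩
    simp only [conjTranspose_eq_transpose_of_trivial, transpose_transpose]
    have hUU' : U * Uᵀ = 1 :=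
      (mul_eq_one_comm_of_card_eq (Fin n) (Fin (nn i)) ℝ (by simpa using heq)).1 hUU
    exact ⟨hUU', hUU, fun j => by rw [← hUint, Matrix.mul_assoc, hUU', Matrix.mul_one]⟩
  · have hPs : (1 - U * Uᵀ).IsHermitian := isHermitian_one.sub (by
      rw [← conjTranspose_eq_transpose_of_trivial]; exact isHermitian_mul_conjTranspose_self _)
    have hPP : (1 - U * Uᵀ) * (1 - U * Uᵀ) = 1 - U * Uᵀ := by
      have : U * Uᵀ * (U * Uᵀ) = U * Uᵀ := by
        rw [Matrix.mul_assoc, ← Matrix.mul_assoc Uᵀ, hUU, Matrix.one_mul]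
      rw [Matrix.mul_sub, Matrix.sub_mul, Matrix.sub_mul, this]
      simp
    obtain ⟨ℓ, V', hV', hV'P⟩ := exists_isometry_of_idempotent hPs hPP
    have hV'U : V'ᵀ * U = 0 := by
      have h1 : V' * V'ᵀ * U = 0 := by
        rw [hV'P, Matrix.sub_mul, Matrix.mul_assoc, hUU]; simp
      calc V'ᵀ * U = V'ᵀ * V' * (V'ᵀ * U) := by rw [hV', Matrix.one_mul]
        _ = V'ᵀ * (V' * V'ᵀ * U) := by simp only [Matrix.mul_assoc]
        _ = 0 := by rw [h1, Matrix.mul_zero]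
    have hUV' : Uᵀ * V' = 0 := by
      simpa using congrArg transpose hV'U
    have hZint : ∀ j, Y i j * V' = V' * (V'ᵀ * Y i j * V') := fun j => by
      rw [← Matrix.mul_assoc, ← Matrix.mul_assoc, hV'P, Matrix.sub_mul, Matrix.sub_mul,
        Matrix.mul_assoc U, hUint', Matrix.mul_assoc U, Matrix.mul_assoc (X j), hUV']
      simp
    refine Or.inr ⟨hlt, ℓ, fun j => V'ᵀ * Y i j * V', (hY i).compress hA hV',
      fromRows Uᵀ V'ᵀ, ?_, ?_, fun j => ?_⟩
    · rw [conjTranspose_eq_transpose_of_trivial, transpose_fromRows, transpose_transpose,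
        transpose_transpose, fromCols_mul_fromRows, hV'P]
      simp
    · rw [conjTranspose_eq_transpose_of_trivial, transpose_fromRows, transpose_transpose,
        transpose_transpose, fromRows_mul_fromCols, hUU, hV', hUV', hV'U, fromBlocks_one]
    · rw [conjTranspose_eq_transpose_of_trivial, transpose_fromRows, transpose_transpose,
        transpose_transpose, fromCols_mul_fromBlocks, fromCols_mul_fromRows]
      simp only [Matrix.mul_zero, add_zero, zero_add]
      rw [← hUint, ← hZint, Matrix.mul_assoc, Matrix.mul_assoc, ← Matrix.mul_add, hV'P]
      simp

/-- Matrix convex combinations of absolute extreme points of the free spectrahedron of `A`. -/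
def InAbsExtHull (A : Fin g → Matrix (Fin d) (Fin d) ℝ) {m : Type} [Fintype m] [DecidableEq m]
    (X : Fin g → Matrix m m ℝ) : Prop :=
  ∃ (ι : Type) (_ : Fintype ι) (nn : ι → ℕ) (Y : ∀ i, Fin g → Matrix (Fin (nn i)) (Fin (nn i)) ℝ)
    (V : ∀ i, Matrix (Fin (nn i)) m ℝ),
    (∀ i, IsAbsExt (fun ℓ => {W : Fin g → Matrix (Fin ℓ) (Fin ℓ) ℝ | InSpec A W}) (Y i)) ∧
    (∑ i, (V i)ᵀ * V i = 1) ∧ ∀ j, X j = ∑ i, (V i)ᵀ * Y i j * V i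

lemma InAbsExtHull.sum {m : Type} [Fintype m] [DecidableEq m] {ι : Type} [Fintype ι]
    {p : ι → Type} [∀ i, Fintype (p i)]
    [∀ i, DecidableEq (p i)] {X : Fin g → Matrix m m ℝ} {Y : ∀ i, Fin g → Matrix (p i) (p i) ℝ}
    {V : ∀ i, Matrix (p i) m ℝ} (hV : ∑ i, (V i)ᵀ * V i = 1)
    (hX : ∀ j, X j = ∑ i, (V i)ᵀ * Y i j * V i) (hY : ∀ i, InAbsExtHull A (Y i)) :
    InAbsExtHull A X := by
  choose κ hκ nn Z U hZ hU hYU using hY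
  refine ⟨Σ i, κ i, inferInstance, fun x => nn x.1 x.2, fun x => Z x.1 x.2,
    fun x => U x.1 x.2 * V x.1, fun x => hZ x.1 x.2, ?_, fun j => ?_⟩
  · rw [← hV, Fintype.sum_sigma]
    refine Finset.sum_congr rfl fun i _ => ?_
    calc _ = (V i)ᵀ * (∑ a, (U i a)ᵀ * U i a) * V i := by
          simp only [transpose_mul, Matrix.mul_sum, Matrix.sum_mul, Matrix.mul_assoc]
      _ = _ := by rw [hU, Matrix.mul_one]
  · rw [hX, Fintype.sum_sigma]
    refine Finset.sum_congr rfl fun i _ => ?_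
    rw [hYU]
    simp only [transpose_mul, Matrix.mul_sum, Matrix.sum_mul, Matrix.mul_assoc]

lemma InAbsExtHull.compress {m p : Type} [Fintype m] [DecidableEq m] [Fintype p] [DecidableEq p]
    {X : Fin g → Matrix m m ℝ} {Y : Fin g → Matrix p p ℝ} {V : Matrix p m ℝ} (hV : Vᵀ * V = 1)
    (hX : ∀ j, X j = Vᵀ * Y j * V) (hY : InAbsExtHull A Y) : InAbsExtHull A X :=
  InAbsExtHull.sum (ι := Unit) (p := fun _ => p) (Y := fun _ => Y) (V := fun _ => V)
    (by simpa using hV) (by simpa using hX) fun _ => hY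

/-- A tuple with a non-scalar symmetric commutant has a nontrivial reducing projection. -/
lemma exists_reducing_projection {n : ℕ} {X : Fin g → Matrix (Fin n) (Fin n) ℝ}
    (h : ¬ HasScalarCommutant X) :
    ∃ P : Matrix (Fin n) (Fin n) ℝ, P.IsHermitian ∧ P * P = P ∧ P ≠ 0 ∧ P ≠ 1 ∧
      ∀ j, X j * P = P * X j := by
  unfold HasScalarCommutant at h
  push Not at h
  obtain ⟨T, hT, hcomm, hns⟩ := h
  obtain ⟨U, μ, hU, hU', hTU⟩ := exists_orthogonal_diagonalization hT
  obtain ⟨a₀, b₀, hab⟩ : ∃ a b, μ b ≠ μ a := by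
    by_contra! hconst
    rcases isEmpty_or_nonempty (Fin n) with hn | ⟨⟨a⟩⟩
    · exact hns 0 (Subsingleton.elim _ _)
    · refine hns (μ a) ?_
      have : diagonal μ = μ a • 1 := by
        rw [smul_one_eq_diagonal]
        exact congrArg diagonal (funext fun b => hconst a b)
      rw [hTU, this, Matrix.mul_smul, Matrix.smul_mul, Matrix.mul_one, hU']
  set χ : Fin n → ℝ := fun a => if μ a = μ a₀ then 1 else 0 with hχ
  have hconj : ∀ B : Matrix (Fin n) (Fin n) ℝ, Uᵀ * (U * B * Uᵀ) * U = B := fun B => by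
    calc _ = (Uᵀ * U) * B * (Uᵀ * U) := by simp only [Matrix.mul_assoc]
      _ = B := by rw [hU]; simp
  have hconj' : ∀ B : Matrix (Fin n) (Fin n) ℝ, U * (Uᵀ * B * U) * Uᵀ = B := fun B => by
    calc _ = (U * Uᵀ) * B * (U * Uᵀ) := by simp only [Matrix.mul_assoc]
      _ = B := by rw [hU']; simp
  have hmul : ∀ B C : Matrix (Fin n) (Fin n) ℝ, U * B * Uᵀ * (U * C * Uᵀ) = U * (B * C) * Uᵀ :=
    fun B C => by
      calc _ = U * B * (Uᵀ * U) * C * Uᵀ := by simp only [Matrix.mul_assoc]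
        _ = _ := by rw [hU]; simp only [Matrix.mul_assoc, Matrix.one_mul]
  have hχP : ∀ B, U * diagonal χ * Uᵀ = B → diagonal χ = Uᵀ * B * U := fun B hB => by
    rw [← hB, hconj]
  refine ⟨U * diagonal χ * Uᵀ, ?_, ?_, fun h0 => ?_, fun h1 => ?_, fun j => ?_⟩
  · unfold IsHermitian
    rw [conjTranspose_eq_transpose_of_trivial]
    simp [Matrix.mul_assoc]
  · rw [hmul, diagonal_mul_diagonal]
    congr 3
    funext a
    simp [hχ]
  · have := congrFun (congrFun (hχP _ h0) a₀) a₀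
    simp [hχ] at this
  · have := congrFun (congrFun (hχP _ h1) b₀) b₀
    rw [Matrix.mul_one, hU] at this
    simp [hχ, hab] at this
  · set X' := Uᵀ * X j * U with hX'
    have hXU : X j = U * X' * Uᵀ := (hconj' _).symm
    have h1 : diagonal μ * X' = X' * diagonal μ := by
      have := hcomm j
      rw [hTU, hXU, hmul, hmul] at this
      rw [← hconj (diagonal μ * X'), this, hconj]
    rw [hXU, hmul, hmul]
    congr 2
    ext a b
    have h2 := congrFun (congrFun h1 a) b
    rw [diagonal_mul, mul_diagonal] at h2 ⊢
    by_cases h3 : X' a b = 0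
    · simp [h3]
    · have : μ a = μ b := mul_right_cancel₀ h3 (h2.trans (mul_comm _ _))
      simp only [hχ, this]
      ring

lemma card_lt_of_isometry {n ℓ : ℕ} {V : Matrix (Fin n) (Fin ℓ) ℝ} (hV : Vᵀ * V = 1)
    (hV1 : V * Vᵀ ≠ 1) : ℓ < n := by
  have h1 : Function.Injective V.mulVecLin := by
    intro x y hxy
    have := congrArg (fun z => Vᵀ *ᵥ z) hxy
    simpa [mulVec_mulVec, hV] using this
  refine lt_of_le_of_ne (by simpa using LinearMap.finrank_le_finrank_of_injective h1) fun heq => ?_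
  exact hV1 ((mul_eq_one_comm_of_card_eq (Fin ℓ) (Fin n) ℝ (by simpa using heq)).1 hV)

lemma inAbsExtHull_of_dilationSubspace_eq_bot (hA : SATuple A) {n : ℕ}
    {X : Fin g → Matrix (Fin n) (Fin n) ℝ} (hX : InSpec A X)
    (hbot : dilationSubspace A X = ⊥) : InAbsExtHull A X := by
  induction n using Nat.strong_induction_on with
  | _ n ih =>
    by_cases hirr : HasScalarCommutant X
    · exact ⟨Unit, inferInstance, fun _ => n, fun _ => X, fun _ => 1,
        fun _ => isAbsExt_of_dilationSubspace_eq_bot hA hX hbot hirr, by simp, by simp⟩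
    obtain ⟨P, hP, hPP, hP0, hP1, hcomm⟩ := exists_reducing_projection hirr
    have key : ∀ Q : Matrix (Fin n) (Fin n) ℝ, Q.IsHermitian → Q * Q = Q → Q ≠ 1 →
        (∀ j, X j * Q = Q * X j) → ∃ (ℓ : ℕ) (V : Matrix (Fin n) (Fin ℓ) ℝ), V * Vᵀ = Q ∧
          InAbsExtHull A fun j => Vᵀ * X j * V := by
      intro Q hQ hQQ hQ1 hcommQ
      obtain ⟨ℓ, V, hV, hVQ⟩ := exists_isometry_of_idempotent hQ hQQ
      have hQV : Q * V = V := by rw [← hVQ, Matrix.mul_assoc, hV, Matrix.mul_one]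
      refine ⟨ℓ, V, hVQ, ih ℓ (card_lt_of_isometry hV (by rwa [hVQ])) (hX.compress hA hV) ?_⟩
      rw [eq_bot_iff]
      intro β hβ
      have h1 := mulVec_mem_dilationSubspace (Y := X) (V := V) (fun j => by
        rw [← Matrix.mul_assoc, ← Matrix.mul_assoc, hVQ, ← hcommQ, Matrix.mul_assoc, hQV]) hβ
      rw [hbot, Submodule.mem_bot] at h1
      rw [Submodule.mem_bot]
      funext j
      have h2 : Vᵀ *ᵥ (V *ᵥ β j) = Vᵀ *ᵥ 0 := congrArg _ (congrFun h1 j)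
      rw [mulVec_mulVec, hV, one_mulVec, mulVec_zero] at h2
      exact h2
    obtain ⟨ℓ₁, V₁, hV₁, hull₁⟩ := key P hP hPP hP1 hcomm
    obtain ⟨ℓ₂, V₂, hV₂, hull₂⟩ := key (1 - P) (isHermitian_one.sub hP)
      (by rw [Matrix.mul_sub, Matrix.sub_mul, Matrix.sub_mul, hPP]; simp)
      (fun h => hP0 (by simpa using h))
      (fun j => by rw [Matrix.mul_sub, Matrix.sub_mul, hcomm]; simp)
    refine InAbsExtHull.sum (ι := Bool) (p := fun b => Fin (bif b then ℓ₁ else ℓ₂))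
      (Y := fun b => match b with
        | true => fun j => V₁ᵀ * X j * V₁
        | false => fun j => V₂ᵀ * X j * V₂)
      (V := fun b => match b with
        | true => V₁ᵀ
        | false => V₂ᵀ) ?_ (fun j => ?_) (fun b => ?_)
    · simp only [Fintype.sum_bool, transpose_transpose]
      exact (congrArg₂ (· + ·) hV₁ hV₂).trans (by simp)
    · simp only [Fintype.sum_bool, transpose_transpose]
      have h1 : ∀ {ℓ : ℕ} (V : Matrix (Fin n) (Fin ℓ) ℝ),
          V * (Vᵀ * X j * V) * Vᵀ = (V * Vᵀ) * X j * (V * Vᵀ) := fun V => by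
        simp only [Matrix.mul_assoc]
      refine Eq.trans ?_ (congrArg₂ (· + ·) (h1 V₁) (h1 V₂)).symm
      simp only [hV₁, hV₂]
      rw [Matrix.mul_assoc, Matrix.mul_assoc, hcomm, Matrix.mul_sub (X j), hcomm,
        ← Matrix.mul_assoc, hPP, Matrix.mul_one, Matrix.mul_sub, Matrix.sub_mul, Matrix.sub_mul,
        ← Matrix.mul_assoc P, hPP]
      simp
    · cases b
      · exact hull₂
      · exact hull₁

lemma inAbsExtHull_of_inSpec (hA : SATuple A) {C : ℝ}
    (hC : ∀ (m : ℕ) (X : Fin g → Matrix (Fin m) (Fin m) ℝ),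
      InSpec A X → (C • (1 : Matrix (Fin m) (Fin m) ℝ) - ∑ j, X j * X j).PosSemidef)
    {m : Type} [Fintype m] [DecidableEq m] {X : Fin g → Matrix m m ℝ} (hX : InSpec A X) :
    InAbsExtHull A X := by
  induction hN : Module.finrank ℝ (dilationSubspace A X) using Nat.strong_induction_on
    generalizing m with
  | _ N ih =>
    by_cases hbot : dilationSubspace A X = ⊥
    · let e := Fintype.equivFin m
      let V : Matrix m (Fin (Fintype.card m)) ℝ := (1 : Matrix m m ℝ).submatrix id e.symm
      have hV : Vᵀ * V = 1 := by
        ext i k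
        simp [V, mul_apply, one_apply]
      have hV' : V * Vᵀ = 1 := (mul_eq_one_comm_of_card_eq _ _ ℝ (by simp)).1 hV
      refine InAbsExtHull.compress (Y := fun j => Vᵀ * X j * V) (V := Vᵀ) (by simpa using hV')
        (fun j => ?_) (inAbsExtHull_of_dilationSubspace_eq_bot hA (hX.compress hA hV) ?_)
      · calc X j = (V * Vᵀ) * X j * (V * Vᵀ) := by rw [hV']; simp
          _ = _ := by simp only [transpose_transpose, Matrix.mul_assoc]
      · rw [eq_bot_iff]
        intro β hβ
        have h1 := mulVec_mem_dilationSubspace (Y := X) (V := V) (fun j => by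
          rw [← Matrix.mul_assoc, ← Matrix.mul_assoc, hV', Matrix.one_mul]) hβ
        rw [hbot, Submodule.mem_bot] at h1
        rw [Submodule.mem_bot]
        funext j
        have h2 : Vᵀ *ᵥ (V *ᵥ β j) = Vᵀ *ᵥ 0 := congrArg _ (congrFun h1 j)
        rw [mulVec_mulVec, hV, one_mulVec, mulVec_zero] at h2
        exact h2
    · obtain ⟨Y, V, hY, hV, hXV, hlt⟩ := exists_dilation_finrank_lt hA hC hX hbot
      exact (ih _ (hN ▸ hlt) hY rfl).compress hV hXV

end Hull

/-- A compact real free spectrahedron is the matrix convex hull of its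
absolute extreme points: `X ∈ D_A^ℝ(n)` iff `X` is a finite matrix convex combination of
absolute extreme points of `D_A^ℝ`. -/
theorem realSpectrahedron_matrixConvexHull_absExtremePoints
    {g d : ℕ} (hg : 0 < g) (hd : 0 < d)
    (A : Fin g → Matrix (Fin d) (Fin d) ℝ) (hA : SATuple A)
    (hbdd : ∃ C : ℝ, 0 < C ∧ ∀ (m : ℕ) (X : Fin g → Matrix (Fin m) (Fin m) ℝ),
      InSpec A X → (C • (1 : Matrix (Fin m) (Fin m) ℝ) - ∑ j, X j * X j).PosSemidef)
    (hclosed : ∀ m : ℕ, IsClosed {X : Fin g → Matrix (Fin m) (Fin m) ℝ | InSpec A X}) :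
    ∀ (n : ℕ) (X : Fin g → Matrix (Fin n) (Fin n) ℝ),
      InSpec A X ↔
        ∃ (k : ℕ) (nn : Fin k → ℕ)
          (Y : ∀ i, Fin g → Matrix (Fin (nn i)) (Fin (nn i)) ℝ)
          (V : ∀ i, Matrix (Fin (nn i)) (Fin n) ℝ),
          (∀ i, IsAbsExt (fun ℓ => {W : Fin g → Matrix (Fin ℓ) (Fin ℓ) ℝ | InSpec A W}) (Y i)) ∧
          (∑ i, (V i)ᴴ * V i = 1) ∧ ∀ j, X j = ∑ i, (V i)ᴴ * Y i j * V i := by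
  obtain ⟨C, -, hC⟩ := hbdd
  refine fun n X => ⟨fun hX => ?_, ?_⟩
  · obtain ⟨ι, _, nn, Y, V, hY, hV, hXV⟩ := inAbsExtHull_of_inSpec hA hC hX
    let e := (Fintype.equivFin ι).symm
    refine ⟨_, fun i => nn (e i), fun i => Y (e i), fun i => V (e i), fun i => hY (e i), ?_,
      fun j => ?_⟩
    · simp only [conjTranspose_eq_transpose_of_trivial]
      rw [e.sum_comp fun i => (V i)ᵀ * V i, hV]
    · simp only [conjTranspose_eq_transpose_of_trivial]
      rw [e.sum_comp fun i => (V i)ᵀ * Y i j * V i, hXV]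
  · rintro ⟨k, nn, Y, V, hY, hV, hXV⟩
    simp only [conjTranspose_eq_transpose_of_trivial] at hV hXV
    exact InSpec.sum hA hV hXV fun i => (hY i).1
end
end

section
/- Let g, d be positive integers and let A ∈ SM_d(ℂ)^g be such that the complex free spectrahedron D_A^ℂ is compact and closed under complex conjugation. Then D_A^ℂ is the matrix convex hull of its absolute extreme points; in particular, every X ∈ D_A^ℂ(n) can be written as a finite matrix convex combination X = Σ_{i=1}^m V_i^* Y^i V_i with Σ_i V_i^* V_i = I_n where each Y^i is an absolute extreme point of D_A^ℂ. -/
open Matrix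
open scoped Kronecker ComplexOrder

noncomputable section

variable {𝕜 : Type*} [RCLike 𝕜]

namespace FreeSpectrahedron

section Pencil

variable {g d : ℕ} {ι κ μ s : Type} {A : Fin g → Matrix (Fin d) (Fin d) ℂ}

/-- The ampliation `I_d ⊗ V`. -/
def amp (d : ℕ) (V : Matrix κ ι ℂ) : Matrix (Fin d × κ) (Fin d × ι) ℂ :=
  (1 : Matrix (Fin d) (Fin d) ℂ) ⊗ₖ V

lemma amp_mul_amp [Fintype κ] (V : Matrix ι κ ℂ) (W : Matrix κ μ ℂ) :
    amp d V * amp d W = amp d (V * W) := by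
  simp [amp, ← mul_kronecker_mul]

lemma amp_one [DecidableEq ι] : amp d (1 : Matrix ι ι ℂ) = 1 := by
  simp [amp]

lemma amp_sum [Fintype s] (V : s → Matrix κ ι ℂ) :
    amp d (∑ i, V i) = ∑ i, amp d (V i) := by
  ext ⟨a, b⟩ ⟨c, e⟩
  simp [amp, kroneckerMap_apply, Matrix.sum_apply, Finset.mul_sum]

lemma amp_conjTranspose (V : Matrix κ ι ℂ) : (amp d V)ᴴ = amp d Vᴴ := by
  simp [amp, conjTranspose_kronecker]

lemma Lam_mul_amp [Fintype κ] (B : Fin g → Matrix ι κ ℂ) (V : Matrix κ μ ℂ) :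
    Lam A B * amp d V = Lam A fun j => B j * V := by
  simp [Lam, amp, Matrix.sum_mul, ← mul_kronecker_mul]

lemma amp_mul_Lam [Fintype κ] (V : Matrix ι κ ℂ) (B : Fin g → Matrix κ μ ℂ) :
    amp d V * Lam A B = Lam A fun j => V * B j := by
  simp [Lam, amp, Matrix.mul_sum, ← mul_kronecker_mul]

lemma Lam_conjTranspose (hA : SATuple A) (B : Fin g → Matrix ι κ ℂ) :
    (Lam A B)ᴴ = Lam A fun j => (B j)ᴴ := by
  simp [Lam, conjTranspose_sum, conjTranspose_kronecker, fun j => (hA j).eq]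

lemma Lam_zero : Lam A (fun _ => (0 : Matrix ι κ ℂ)) = 0 := by
  simp [Lam]

lemma Lam_add (B C : Fin g → Matrix ι κ ℂ) :
    Lam A (fun j => B j + C j) = Lam A B + Lam A C := by
  simp [Lam, kronecker_add, Finset.sum_add_distrib]

lemma Lam_smul (c : ℂ) (B : Fin g → Matrix ι κ ℂ) :
    Lam A (fun j => c • B j) = c • Lam A B := by
  simp [Lam, kronecker_smul, Finset.smul_sum]

lemma Lam_sum [Fintype s] (B : s → Fin g → Matrix ι κ ℂ) :
    Lam A (fun j => ∑ i, B i j) = ∑ i, Lam A (B i) := by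
  ext ⟨a, b⟩ ⟨c, e⟩
  simp only [Lam, Matrix.sum_apply, kroneckerMap_apply, Finset.mul_sum]
  exact Finset.sum_comm

lemma LPencil_mul_amp [Fintype κ] [DecidableEq κ] (Y : Fin g → Matrix κ κ ℂ)
    (V : Matrix κ ι ℂ) : LPencil A Y * amp d V = amp d V + Lam A fun j => Y j * V := by
  simp [LPencil, Matrix.add_mul, Lam_mul_amp]

lemma amp_mul_LPencil [Fintype κ] [DecidableEq κ] (V : Matrix ι κ ℂ)
    (Y : Fin g → Matrix κ κ ℂ) : amp d V * LPencil A Y = amp d V + Lam A fun j => V * Y j := by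
  simp [LPencil, Matrix.mul_add, amp_mul_Lam]

/-- `X` is the matrix convex combination `∑ i, (V i)ᴴ Y i (V i)`. -/
def IsComb [Fintype s] [Fintype ι] [DecidableEq ι] {κ : s → Type} [∀ i, Fintype (κ i)]
    (Y : ∀ i, Fin g → Matrix (κ i) (κ i) ℂ) (V : ∀ i, Matrix (κ i) ι ℂ)
    (X : Fin g → Matrix ι ι ℂ) : Prop :=
  ∑ i, (V i)ᴴ * V i = 1 ∧ ∀ j, X j = ∑ i, (V i)ᴴ * Y i j * V i

section Comb

variable [Fintype s] [Fintype ι] [DecidableEq ι] {κ : s → Type} [∀ i, Fintype (κ i)]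
  [∀ i, DecidableEq (κ i)] {Y : ∀ i, Fin g → Matrix (κ i) (κ i) ℂ}
  {V : ∀ i, Matrix (κ i) ι ℂ} {X : Fin g → Matrix ι ι ℂ}

lemma IsComb.LPencil_eq (h : IsComb Y V X) :
    LPencil A X = ∑ i, (amp d (V i))ᴴ * LPencil A (Y i) * amp d (V i) := by
  have hX : X = fun j => ∑ i, (V i)ᴴ * Y i j * V i := funext h.2
  simp only [amp_conjTranspose, Matrix.mul_assoc, LPencil_mul_amp, Matrix.mul_add, amp_mul_amp,
    amp_mul_Lam, Finset.sum_add_distrib, ← amp_sum, h.1, amp_one, ← Lam_sum]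
  simp [hX, LPencil, Matrix.mul_assoc]

lemma IsComb.inSpec (h : IsComb Y V X) (hY : ∀ i, InSpec A (Y i)) : InSpec A X := by
  refine ⟨fun j => ?_, ?_⟩
  · rw [h.2 j, IsHermitian, conjTranspose_sum]
    refine Finset.sum_congr rfl fun i _ => ?_
    simp [conjTranspose_mul, Matrix.mul_assoc, ((hY i).1 j).eq]
  · rw [h.LPencil_eq]
    exact posSemidef_sum _ fun i _ => (hY i).2.conjTranspose_mul_mul_same _

lemma IsComb.kernel (h : IsComb Y V X) (hY : ∀ i, InSpec A (Y i)) {v : Fin d × ι → ℂ}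
    (hv : LPencil A X *ᵥ v = 0) (i : s) : LPencil A (Y i) *ᵥ (amp d (V i) *ᵥ v) = 0 := by
  have h0 : ∑ i, star (amp d (V i) *ᵥ v) ⬝ᵥ LPencil A (Y i) *ᵥ (amp d (V i) *ᵥ v) = 0 := by
    have : star v ⬝ᵥ LPencil A X *ᵥ v = 0 := by simp [hv]
    rw [h.LPencil_eq, Matrix.sum_mulVec, dotProduct_sum] at this
    rw [← this]
    refine Finset.sum_congr rfl fun i _ => ?_
    rw [star_mulVec, ← dotProduct_mulVec, mulVec_mulVec, mulVec_mulVec, Matrix.mul_assoc]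
  rw [Finset.sum_eq_zero_iff_of_nonneg fun i _ => (hY i).2.dotProduct_mulVec_nonneg _] at h0
  exact ((hY i).2.dotProduct_mulVec_zero_iff _).1 (h0 i (Finset.mem_univ i))

end Comb

/-- `β` belongs to the dilation subspace of `Y`: `ker L_A(Y) ⊆ ker Λ_A(β^*)`. -/
def DilDir [Fintype ι] [DecidableEq ι] (A : Fin g → Matrix (Fin d) (Fin d) ℂ)
    (Y : Fin g → Matrix ι ι ℂ) (β : Fin g → Matrix ι Unit ℂ) : Prop :=
  ∀ v, LPencil A Y *ᵥ v = 0 → Lam A (fun j => (β j)ᴴ) *ᵥ v = 0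

/-- The dilation subspace of `Y` is trivial. -/
def Arveson [Fintype ι] [DecidableEq ι] (A : Fin g → Matrix (Fin d) (Fin d) ℂ)
    (Y : Fin g → Matrix ι ι ℂ) : Prop :=
  ∀ β, DilDir A Y β → β = 0

lemma IsComb.dilDir [Fintype s] [Fintype ι] [DecidableEq ι] {κ : s → Type} [∀ i, Fintype (κ i)]
    [∀ i, DecidableEq (κ i)] {Y : ∀ i, Fin g → Matrix (κ i) (κ i) ℂ}
    {V : ∀ i, Matrix (κ i) ι ℂ} {X : Fin g → Matrix ι ι ℂ} (h : IsComb Y V X)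
    (hY : ∀ i, InSpec A (Y i)) (i : s) (w : Matrix (κ i) Unit ℂ) :
    DilDir A X fun j => ((V i)ᴴ * Y i j - X j * (V i)ᴴ) * w := by
  intro v hv
  have hX := (h.inSpec hY).1
  have h1 := congrArg (amp d wᴴ *ᵥ ·) (h.kernel hY hv i)
  have h2 := congrArg (amp d (wᴴ * V i) *ᵥ ·) hv
  simp only [mulVec_mulVec, mulVec_zero, ← Matrix.mul_assoc, amp_mul_LPencil, Matrix.add_mul,
    amp_mul_amp, Lam_mul_amp, add_mulVec] at h1 h2
  have h3 : (fun j => (((V i)ᴴ * Y i j - X j * (V i)ᴴ) * w)ᴴ) =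
      fun j => wᴴ * Y i j * V i + (-1 : ℂ) • (wᴴ * V i * X j) := by
    funext j
    simp [conjTranspose_mul, ((hY i).1 j).eq, (hX j).eq, Matrix.mul_assoc, Matrix.mul_add,
      sub_eq_add_neg]
  rw [h3, Lam_add, add_mulVec, Lam_smul, smul_mulVec,
    eq_neg_of_add_eq_zero_right (b := Lam A _ *ᵥ v) h1,
    eq_neg_of_add_eq_zero_right (b := Lam A _ *ᵥ v) h2]
  simp

lemma IsComb.intertwine [Fintype s] [Fintype ι] [DecidableEq ι] {κ : s → Type}
    [∀ i, Fintype (κ i)]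
    [∀ i, DecidableEq (κ i)] {Y : ∀ i, Fin g → Matrix (κ i) (κ i) ℂ}
    {V : ∀ i, Matrix (κ i) ι ℂ} {X : Fin g → Matrix ι ι ℂ} (h : IsComb Y V X)
    (hY : ∀ i, InSpec A (Y i)) (hX : Arveson A X) (i : s) (j : Fin g) :
    Y i j * V i = V i * X j := by
  have h1 : (V i)ᴴ * Y i j = X j * (V i)ᴴ := by
    rw [← sub_eq_zero]
    ext a b
    have := congrFun (hX _ (h.dilDir hY i (Matrix.single b () 1))) j
    have := congrFun (congrFun this a) ()
    simpa using this
  have h2 := congrArg conjTranspose h1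
  simpa [conjTranspose_mul, ((hY i).1 j).eq, ((h.inSpec hY).1 j).eq] using h2

lemma isComb_single [Fintype ι] [DecidableEq ι] [Fintype κ]
    {V : Matrix κ ι ℂ} (hV : Vᴴ * V = 1) (Y : Fin g → Matrix κ κ ℂ) :
    IsComb (s := Unit) (fun _ => Y) (fun _ => V) (fun j => Vᴴ * Y j * V) := by
  simp [IsComb, hV]

lemma _root_.InSpec.compress_s1 [Fintype ι] [DecidableEq ι] [Fintype κ] [DecidableEq κ]
    {V : Matrix κ ι ℂ} (hV : Vᴴ * V = 1) {Y : Fin g → Matrix κ κ ℂ} (hY : InSpec A Y) :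
    InSpec A fun j => Vᴴ * Y j * V :=
  (isComb_single hV Y).inSpec fun _ => hY

end Pencil

section Perturbation

variable {n : Type} [Fintype n] [DecidableEq n]

lemma exists_unitary_diagonalization {H : Matrix n n ℂ} (hH : H.IsHermitian) :
    ∃ (U : Matrix n n ℂ) (h : n → ℝ), Uᴴ * U = 1 ∧ U * Uᴴ = 1 ∧
      H = U * diagonal (fun i => (h i : ℂ)) * Uᴴ := by
  refine ⟨hH.eigenvectorUnitary, hH.eigenvalues, ?_, ?_, ?_⟩
  · exact Unitary.coe_star_mul_self hH.eigenvectorUnitary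
  · exact Unitary.coe_mul_star_self hH.eigenvectorUnitary
  · conv_lhs => rw [hH.spectral_theorem]
    rfl

lemma posSemidef_unitary_diagonal (U : Matrix n n ℂ) {h : n → ℝ} (h0 : ∀ i, 0 ≤ h i) :
    (U * diagonal (fun i => (h i : ℂ)) * Uᴴ).PosSemidef := by
  refine PosSemidef.mul_mul_conjTranspose_same (posSemidef_diagonal_iff.2 fun i => ?_) U
  exact_mod_cast h0 i

lemma exists_bound_posSemidef {H : Matrix n n ℂ} (hH : H.IsHermitian) :
    ∃ C : ℝ, 0 < C ∧ ((C : ℂ) • (1 : Matrix n n ℂ) + H).PosSemidef ∧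
      ((C : ℂ) • (1 : Matrix n n ℂ) - H).PosSemidef := by
  obtain ⟨U, h, hU, hU', rfl⟩ := exists_unitary_diagonalization hH
  set C : ℝ := ∑ i, |h i| + 1 with hC
  have hle : ∀ i, |h i| ≤ C := fun i => by
    have := Finset.single_le_sum (f := fun i => |h i|) (fun i _ => abs_nonneg _)
      (Finset.mem_univ i)
    linarith
  have key : (C : ℂ) • (1 : Matrix n n ℂ) = U * diagonal (fun _ => (C : ℂ)) * Uᴴ := by
    rw [← smul_one_eq_diagonal]
    simp [hU']
  have hC0 : 0 < C := by positivity
  refine ⟨C, hC0, ?_, ?_⟩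
  · rw [key, ← Matrix.add_mul, ← Matrix.mul_add, diagonal_add]
    have := posSemidef_unitary_diagonal U (h := fun i => C + h i)
      fun i => by linarith [neg_abs_le (h i), hle i]
    simpa using this
  · rw [key, ← Matrix.sub_mul, ← Matrix.mul_sub, diagonal_sub]
    have := posSemidef_unitary_diagonal U (h := fun i => C - h i)
      fun i => by linarith [le_abs_self (h i), hle i]
    simpa using this

lemma exists_pos_le_of_ne_zero {s : Type*} [Fintype s] (h : s → ℝ) (h0 : ∀ i, 0 ≤ h i) :
    ∃ δ : ℝ, 0 < δ ∧ ∀ i, h i ≠ 0 → δ ≤ h i := by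
  classical
  obtain hs | hs := (Finset.univ.filter fun i => h i ≠ 0).eq_empty_or_nonempty
  · refine ⟨1, one_pos, fun i hi => ?_⟩
    have : i ∈ Finset.univ.filter fun i => h i ≠ 0 := by simp [hi]
    simp [hs] at this
  · obtain ⟨a, ha, hmin⟩ := Finset.exists_min_image _ h hs
    refine ⟨h a, lt_of_le_of_ne (h0 a) ?_, fun i hi => hmin i (by simpa using hi)⟩
    simpa [eq_comm] using ha

/-- A Hermitian matrix vanishing on the kernel of a positive semidefinite matrix is a
two-sided admissible perturbation of it. -/
lemma _root_.Matrix.PosSemidef.exists_perturbation {P H : Matrix n n ℂ} (hP : P.PosSemidef)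
    (hH : H.IsHermitian) (hker : ∀ v, P *ᵥ v = 0 → H *ᵥ v = 0) :
    ∃ t : ℝ, 0 < t ∧ (P + (t : ℂ) • H).PosSemidef ∧ (P - (t : ℂ) • H).PosSemidef := by
  obtain ⟨U, h, hU, hU', hPU⟩ := exists_unitary_diagonalization hP.1
  have h0 : ∀ i, 0 ≤ h i := by
    have h1 : diagonal (fun i => (h i : ℂ)) = Uᴴ * P * U := by
      rw [hPU]
      simp only [Matrix.mul_assoc, hU, Matrix.mul_one]
      simp [← Matrix.mul_assoc, hU]
    have h2 := hP.conjTranspose_mul_mul_same U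
    rw [← h1, posSemidef_diagonal_iff] at h2
    exact fun i => by exact_mod_cast h2 i
  obtain ⟨δ, hδ, hδh⟩ := exists_pos_le_of_ne_zero h h0
  obtain ⟨C, hC, hC1, hC2⟩ := exists_bound_posSemidef hH
  set q : n → ℝ := fun i => if h i = 0 then 0 else 1 with hq
  set Q : Matrix n n ℂ := U * diagonal (fun i => (q i : ℂ)) * Uᴴ with hQ
  have hQH : Qᴴ = Q := by
    simp [hQ, conjTranspose_mul, Matrix.mul_assoc, diagonal_conjTranspose, Pi.star_def]
  have hQQ : Q * Q = Q := by
    have : Q * Q = U * diagonal (fun i => (q i : ℂ)) * (Uᴴ * U) *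
        diagonal (fun i => (q i : ℂ)) * Uᴴ := by simp [hQ, Matrix.mul_assoc]
    rw [this, hU, Matrix.mul_one, Matrix.mul_assoc U, diagonal_mul_diagonal, hQ]
    congr! 4 with i
    by_cases hi : h i = 0 <;> simp [hq, hi]
  have hPQ : P * (1 - Q) = 0 := by
    have h1 : (1 : Matrix n n ℂ) - Q = U * diagonal (fun i => ((1 - q i : ℝ) : ℂ)) * Uᴴ := by
      have h2 : diagonal (fun i => ((1 - q i : ℝ) : ℂ)) =
          1 - diagonal (fun i => (q i : ℂ)) := by
        rw [← diagonal_one, diagonal_sub]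
        simp
      rw [h2, Matrix.mul_sub, Matrix.sub_mul, Matrix.mul_one, hU']
    have h3 : P * (1 - Q) = U * diagonal (fun i => (h i : ℂ)) * (Uᴴ * U) *
        diagonal (fun i => ((1 - q i : ℝ) : ℂ)) * Uᴴ := by
      rw [h1, hPU]; simp only [Matrix.mul_assoc]
    rw [h3, hU, Matrix.mul_one, Matrix.mul_assoc U, diagonal_mul_diagonal]
    have h4 : (fun i => (h i : ℂ) * ((1 - q i : ℝ) : ℂ)) = 0 := by
      funext i
      by_cases hi : h i = 0 <;> simp [hq, hi]
    rw [h4]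
    simp
  have hHQ : H * Q = H := by
    have h1 : H * (1 - Q) = 0 := by
      ext a b
      have h2 := hker ((1 - Q).col b) (by
        funext c
        exact congrFun (congrFun hPQ c) b)
      exact congrFun h2 a
    rw [Matrix.mul_sub, Matrix.mul_one, sub_eq_zero] at h1
    exact h1.symm
  have hQH' : Q * H = H := by
    have := congrArg conjTranspose hHQ
    rwa [conjTranspose_mul, hQH, hH.eq] at this
  have hPδ : (P - (δ : ℂ) • Q).PosSemidef := by
    have h1 : P - (δ : ℂ) • Q = U * diagonal (fun i => ((h i - δ * q i : ℝ) : ℂ)) * Uᴴ := by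
      have h2 : diagonal (fun i => ((h i - δ * q i : ℝ) : ℂ)) =
          diagonal (fun i => (h i : ℂ)) - (δ : ℂ) • diagonal (fun i => (q i : ℂ)) := by
        rw [← diagonal_smul, diagonal_sub]
        simp
      rw [h2, Matrix.mul_sub, Matrix.sub_mul, ← hPU, hQ]
      simp
    rw [h1]
    refine posSemidef_unitary_diagonal U fun i => ?_
    by_cases hi : h i = 0
    · simp [hq, hi]
    · simpa [hq, hi] using hδh i hi
  have ht : (0 : ℂ) ≤ ((δ / C : ℝ) : ℂ) := by exact_mod_cast (div_pos hδ hC).le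
  have hCne : (C : ℂ) ≠ 0 := by exact_mod_cast hC.ne'
  refine ⟨δ / C, div_pos hδ hC, ?_, ?_⟩
  · have h1 := hPδ.add ((hC1.conjTranspose_mul_mul_same Q).smul ht)
    convert h1 using 1
    simp only [hQH, Matrix.mul_add, Matrix.add_mul, Matrix.mul_smul, Matrix.smul_mul,
      Matrix.mul_one, hQQ, hQH', hHQ, smul_add, smul_smul]
    push_cast
    rw [div_mul_cancel₀ _ hCne]
    abel
  · have h1 := hPδ.add ((hC2.conjTranspose_mul_mul_same Q).smul ht)
    convert h1 using 1
    simp only [hQH, Matrix.mul_sub, Matrix.sub_mul, Matrix.mul_smul, Matrix.smul_mul,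
      Matrix.mul_one, hQQ, hQH', hHQ, smul_sub, smul_smul]
    push_cast
    rw [div_mul_cancel₀ _ hCne]
    abel

lemma _root_.InSpec.exists_perturbation {g d : ℕ} {A : Fin g → Matrix (Fin d) (Fin d) ℂ}
    (hA : SATuple A) {Y N : Fin g → Matrix n n ℂ} (hY : InSpec A Y) (hN : SATuple N)
    (hker : ∀ v, LPencil A Y *ᵥ v = 0 → Lam A N *ᵥ v = 0) :
    ∃ t : ℝ, 0 < t ∧ InSpec A (fun j => Y j + (t : ℂ) • N j) ∧
      InSpec A (fun j => Y j - (t : ℂ) • N j) := by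
  have hNH : (Lam A N).IsHermitian := by
    rw [IsHermitian, Lam_conjTranspose hA]
    congr; funext j; exact hN j
  have hsa : ∀ (t : ℝ) j, ((t : ℂ) • N j).IsHermitian := fun t j => by
    rw [IsHermitian, conjTranspose_smul, (hN j).eq]; simp
  obtain ⟨t, ht, h1, h2⟩ := PosSemidef.exists_perturbation hY.2 hNH hker
  refine ⟨t, ht, ⟨fun j => (hY.1 j).add (hsa t j), ?_⟩,
    ⟨fun j => (hY.1 j).sub (hsa t j), ?_⟩⟩
  · rwa [LPencil, Lam_add, Lam_smul, ← add_assoc]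
  · have h3 : (fun j => Y j - (t : ℂ) • N j) = fun j => Y j + (-t : ℂ) • N j := by
      funext j; rw [neg_smul, sub_eq_add_neg]
    rw [h3, LPencil, Lam_add, Lam_smul, ← add_assoc, neg_smul, ← sub_eq_add_neg]
    exact h2

end Perturbation

section Dilation

variable {g d : ℕ} {ι κ μ : Type} {A : Fin g → Matrix (Fin d) (Fin d) ℂ}

lemma _root_.InSpec.comb_two [Fintype ι] [DecidableEq ι] [Fintype κ] [DecidableEq κ] [Fintype μ]
    [DecidableEq μ] {V : Matrix κ ι ℂ} {W : Matrix μ ι ℂ} (h : Vᴴ * V + Wᴴ * W = 1)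
    {Y : Fin g → Matrix κ κ ℂ} {Z : Fin g → Matrix μ μ ℂ} (hY : InSpec A Y)
    (hZ : InSpec A Z) : InSpec A fun j => Vᴴ * Y j * V + Wᴴ * Z j * W := by
  refine ⟨fun j => ?_, ?_⟩
  · simp [IsHermitian, conjTranspose_add, conjTranspose_mul, Matrix.mul_assoc, (hY.1 j).eq,
      (hZ.1 j).eq]
  · have h1 : LPencil A (fun j => Vᴴ * Y j * V + Wᴴ * Z j * W) =
        (amp d V)ᴴ * LPencil A Y * amp d V + (amp d W)ᴴ * LPencil A Z * amp d W := by
      rw [LPencil, Lam_add, ← amp_one, ← h, amp_conjTranspose, amp_conjTranspose,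
        Matrix.mul_assoc, Matrix.mul_assoc, LPencil_mul_amp, LPencil_mul_amp]
      simp only [Matrix.mul_add, amp_mul_amp, amp_mul_Lam, Matrix.mul_assoc]
      have : amp d (Vᴴ * V + Wᴴ * W) = amp d (Vᴴ * V) + amp d (Wᴴ * W) :=
        kronecker_add _ _ _
      rw [this]
      abel
    rw [h1]
    exact (hY.2.conjTranspose_mul_mul_same _).add (hZ.2.conjTranspose_mul_mul_same _)

lemma inSpec_zero [Fintype ι] [DecidableEq ι] :
    InSpec A (fun _ => (0 : Matrix ι ι ℂ)) :=
  ⟨fun _ => isHermitian_zero, by rw [LPencil, Lam_zero, add_zero]; exact PosSemidef.one⟩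

/-- Entrywise reality of a tuple of complex matrices. -/
def IsRealTuple (B : Fin g → Matrix κ ι ℂ) : Prop :=
  ∀ j a b, star (B j a b) = B j a b

/-- The inclusion of the first summand of `ℂ^ι ⊕ ℂ`. -/
def inclL (ι : Type) [DecidableEq ι] : Matrix (ι ⊕ Unit) ι ℂ := fromRows 1 0

/-- The inclusion of the second summand of `ℂ^ι ⊕ ℂ`. -/
def inclR (ι : Type) : Matrix (ι ⊕ Unit) Unit ℂ := fromRows 0 1

/-- The dilation `[[Y, β], [β^*, γ]]`. -/
def dil (Y : Fin g → Matrix ι ι ℂ) (β : Fin g → Matrix ι Unit ℂ)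
    (γ : Fin g → Matrix Unit Unit ℂ) : Fin g → Matrix (ι ⊕ Unit) (ι ⊕ Unit) ℂ :=
  fun j => fromBlocks (Y j) (β j) (β j)ᴴ (γ j)

@[simp] lemma inclR_inclR [Fintype ι] : (inclR ι)ᴴ * inclR ι = 1 := by
  simp [inclR, conjTranspose_fromRows_eq_fromCols_conjTranspose, fromCols_mul_fromRows]

lemma inclL_conjTranspose [DecidableEq ι] : (inclL ι)ᴴ = fromCols 1 0 := by
  simp [inclL, conjTranspose_fromRows_eq_fromCols_conjTranspose]

lemma inclR_conjTranspose : (inclR ι)ᴴ = fromCols 0 1 := by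
  simp [inclR, conjTranspose_fromRows_eq_fromCols_conjTranspose]

section Incl

variable [Fintype ι] [DecidableEq ι]

@[simp] lemma inclL_inclL : (inclL ι)ᴴ * inclL ι = 1 := by
  simp [inclL, conjTranspose_fromRows_eq_fromCols_conjTranspose, fromCols_mul_fromRows]

@[simp] lemma inclL_inclR : (inclL ι)ᴴ * inclR ι = 0 := by
  simp [inclL, inclR, conjTranspose_fromRows_eq_fromCols_conjTranspose, fromCols_mul_fromRows]

@[simp] lemma inclR_inclL : (inclR ι)ᴴ * inclL ι = 0 := by
  simp [inclL, inclR, conjTranspose_fromRows_eq_fromCols_conjTranspose, fromCols_mul_fromRows]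

lemma incl_add_incl : inclL ι * (inclL ι)ᴴ + inclR ι * (inclR ι)ᴴ = 1 := by
  rw [inclL_conjTranspose, inclR_conjTranspose, inclL, inclR, fromRows_mul_fromCols,
    fromRows_mul_fromCols, fromBlocks_add]
  simp [fromBlocks_one]

variable (Y : Fin g → Matrix ι ι ℂ) (β : Fin g → Matrix ι Unit ℂ)
  (γ : Fin g → Matrix Unit Unit ℂ) (j : Fin g)

lemma dil_mul_inclL : dil Y β γ j * inclL ι = inclL ι * Y j + inclR ι * (β j)ᴴ := by
  simp [dil, inclL, inclR, fromBlocks_mul_fromRows, fromRows_mul]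
  ext (a | a) b <;> simp

lemma dil_mul_inclR : dil Y β γ j * inclR ι = inclL ι * β j + inclR ι * γ j := by
  simp [dil, inclL, inclR, fromBlocks_mul_fromRows, fromRows_mul]
  ext (a | a) b <;> simp

lemma dil_compress : (inclL ι)ᴴ * dil Y β γ j * inclL ι = Y j := by
  rw [Matrix.mul_assoc, dil_mul_inclL, Matrix.mul_add, ← Matrix.mul_assoc, ← Matrix.mul_assoc]
  simp

lemma dil_corner : (inclL ι)ᴴ * dil Y β γ j * inclR ι = β j := by
  rw [Matrix.mul_assoc, dil_mul_inclR, Matrix.mul_add, ← Matrix.mul_assoc, ← Matrix.mul_assoc]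
  simp

variable {Y β γ j}

lemma eq_dil_of_isHermitian {X : Fin g → Matrix (ι ⊕ Unit) (ι ⊕ Unit) ℂ} (hX : SATuple X) :
    X = dil (fun j => (inclL ι)ᴴ * X j * inclL ι) (fun j => (inclL ι)ᴴ * X j * inclR ι)
      (fun j => (inclR ι)ᴴ * X j * inclR ι) := by
  funext j
  obtain ⟨a, b, c, e, h⟩ : ∃ a b c e, X j = fromBlocks a b c e :=
    ⟨_, _, _, _, (fromBlocks_toBlocks (X j)).symm⟩
  have h2 := hX j
  rw [h, isHermitian_fromBlocks_iff] at h2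
  rw [dil, h, inclL_conjTranspose, inclR_conjTranspose, inclL, inclR]
  simp [fromCols_mul_fromBlocks, fromCols_mul_fromRows, h2.2.1]

lemma _root_.InSpec.dilDir (h : InSpec A (dil Y β γ)) : DilDir A Y β := by
  have h1 := (isComb_single inclL_inclL (dil Y β γ)).dilDir (fun _ => h) () (inclR ι)
  simp only [dil_compress, Matrix.sub_mul, Matrix.mul_assoc _ _ (inclR ι),
    inclL_inclR, Matrix.mul_zero, sub_zero] at h1
  simpa only [← Matrix.mul_assoc, dil_corner] using h1

lemma DilDir.exists_dil (hA : SATuple A) (hY : InSpec A Y) (hβ : DilDir A Y β) :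
    ∃ t : ℝ, 0 < t ∧ InSpec A (dil Y (fun j => (t : ℂ) • β j) fun _ => 0) := by
  set N : Fin g → Matrix (ι ⊕ Unit) (ι ⊕ Unit) ℂ := dil (fun _ => 0) β fun _ => 0 with hN
  set Y₀ : Fin g → Matrix (ι ⊕ Unit) (ι ⊕ Unit) ℂ := dil Y (fun _ => 0) fun _ => 0 with hY₀
  have hY₀' : InSpec A Y₀ := by
    have := InSpec.comb_two (V := (inclL ι)ᴴ) (W := (inclR ι)ᴴ) (by
      simpa using incl_add_incl (ι := ι)) hY (inSpec_zero (A := A) (ι := Unit))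
    convert this using 1
    funext j
    rw [conjTranspose_conjTranspose, Matrix.mul_zero, Matrix.zero_mul, add_zero,
      inclL_conjTranspose, inclL, fromRows_mul, fromRows_mul_fromCols]
    simp [hY₀, dil]
  have hNsa : SATuple N := fun j => by
    simp [hN, dil, isHermitian_fromBlocks_iff]
  obtain ⟨t, ht, h1, -⟩ := hY₀'.exists_perturbation hA hNsa (by
    intro v hv
    have e1 := congrArg (amp d (inclL ι)ᴴ *ᵥ ·) hv
    have e2 := congrArg (amp d (inclR ι)ᴴ *ᵥ ·) hv
    have f1 : ∀ j, (inclL ι)ᴴ * Y₀ j = Y j * (inclL ι)ᴴ := fun j => by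
      simp [hY₀, dil, inclL, conjTranspose_fromRows_eq_fromCols_conjTranspose,
        fromCols_mul_fromBlocks, mul_fromCols]
    have f2 : ∀ j, (inclR ι)ᴴ * Y₀ j = 0 := fun j => by
      simp [hY₀, dil, inclR, conjTranspose_fromRows_eq_fromCols_conjTranspose,
        fromCols_mul_fromBlocks]
    have f3 : ∀ j, N j = inclL ι * β j * (inclR ι)ᴴ + inclR ι * (β j)ᴴ * (inclL ι)ᴴ := fun j => by
      rw [inclL_conjTranspose, inclR_conjTranspose, inclL, inclR]
      ext (a | a) (b | b) <;> simp [hN, dil, fromRows_mul, mul_fromCols]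
    simp only [mulVec_mulVec, mulVec_zero, amp_mul_LPencil, f1, f2, Lam_zero, add_zero] at e1 e2
    rw [← LPencil_mul_amp, ← mulVec_mulVec] at e1
    rw [show N = _ from funext f3, Lam_add, ← Lam_mul_amp, add_mulVec, ← mulVec_mulVec, e2]
    simp only [Matrix.mul_assoc, ← amp_mul_Lam, ← Lam_mul_amp]
    rw [← mulVec_mulVec, ← mulVec_mulVec, ← mulVec_mulVec, hβ _ e1]
    simp)
  refine ⟨t, ht, ?_⟩
  convert h1 using 1
  funext j
  simp [hY₀, hN, dil, fromBlocks_smul, fromBlocks_add, conjTranspose_smul]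

end Incl

end Dilation

section Descent

variable {g d : ℕ} {ι κ : Type} {A : Fin g → Matrix (Fin d) (Fin d) ℂ}

/-- The tuple of `1 × 1` matrices with given real entries. -/
def scalarTuple (γ : Fin g → ℝ) : Fin g → Matrix Unit Unit ℂ := fun j => of fun _ _ => (γ j : ℂ)

lemma isRealTuple_dil {Y : Fin g → Matrix ι ι ℂ} {β : Fin g → Matrix ι Unit ℂ}
    (hY : IsRealTuple Y) (hβ : IsRealTuple β) (γ : Fin g → ℝ) :
    IsRealTuple (dil Y β (scalarTuple γ)) := by
  rintro j (a | a) (b | b)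
  · exact hY j a b
  · exact hβ j a b
  · simp [dil, hβ j b a]
  · simp [dil, scalarTuple]

lemma continuous_dil (Y : Fin g → Matrix ι ι ℂ) (β : Fin g → Matrix ι Unit ℂ) :
    Continuous fun p : ℝ × (Fin g → ℝ) =>
      dil Y (fun j => (p.1 : ℂ) • β j) (scalarTuple p.2) := by
  refine continuous_pi fun j => continuous_matrix fun a b => ?_
  rcases a with a | a <;> rcases b with b | b <;> simp [dil, scalarTuple] <;> fun_prop

variable [Fintype ι] [DecidableEq ι]

lemma DilDir.add {Y : Fin g → Matrix ι ι ℂ} {β β' : Fin g → Matrix ι Unit ℂ}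
    (h : DilDir A Y β) (h' : DilDir A Y β') : DilDir A Y fun j => β j + β' j := by
  intro v hv
  simp only [conjTranspose_add, Lam_add, add_mulVec, h v hv, h' v hv, add_zero]

lemma DilDir.smul {Y : Fin g → Matrix ι ι ℂ} {β : Fin g → Matrix ι Unit ℂ}
    (h : DilDir A Y β) (c : ℂ) : DilDir A Y fun j => c • β j := by
  intro v hv
  simp only [conjTranspose_smul, Lam_smul, smul_mulVec, h v hv, smul_zero]

/-- The real directions in the dilation subspace of `Y`. -/
def realDir (A : Fin g → Matrix (Fin d) (Fin d) ℂ) (Y : Fin g → Matrix ι ι ℂ) :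
    Submodule ℝ (Fin g → Matrix ι Unit ℂ) where
  carrier := {β | IsRealTuple β ∧ DilDir A Y β}
  zero_mem' := ⟨fun j a b => by simp, fun v _ => by
    simp only [Pi.zero_apply, conjTranspose_zero, Lam_zero, zero_mulVec]⟩
  add_mem' h h' := ⟨fun j a b => by
    simp only [Pi.add_apply, Matrix.add_apply, star_add, h.1 j a b, h'.1 j a b], h.2.add h'.2⟩
  smul_mem' c β h := ⟨fun j a b => by
    simp only [Pi.smul_apply, Matrix.smul_apply, star_smul, h.1 j a b, star_trivial], by
    have := h.2.smul (c : ℂ)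
    exact this⟩

lemma eq_scalarTuple {γ : Fin g → Matrix Unit Unit ℂ} (h : ∀ j, (γ j).IsHermitian) :
    γ = scalarTuple fun j => (γ j () ()).re := by
  funext j
  ext a b
  have := congrFun (congrFun (h j) ()) ()
  exact (Complex.conj_eq_iff_re.1 this).symm

/-- Among the dilations of `Y` in the direction `β`, one whose off-diagonal part is maximal and
whose corner is maximal among those. -/
lemma exists_maximal_dil (hA : SATuple A) {M : ℝ}
    (hbdd : ∀ X : Fin g → Matrix (ι ⊕ Unit) (ι ⊕ Unit) ℂ, InSpec A X → ∀ j a b, ‖X j a b‖ ≤ M)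
    (hclosed : IsClosed {X : Fin g → Matrix (ι ⊕ Unit) (ι ⊕ Unit) ℂ | InSpec A X})
    {Y : Fin g → Matrix ι ι ℂ} (hY : InSpec A Y) {β : Fin g → Matrix ι Unit ℂ}
    (hβ : DilDir A Y β) (hβ0 : β ≠ 0) :
    ∃ (c : ℝ) (γ : Fin g → ℝ), 0 < c ∧
      InSpec A (dil Y (fun j => (c : ℂ) • β j) (scalarTuple γ)) ∧
      (∀ (c' : ℝ) γ', InSpec A (dil Y (fun j => (c' : ℂ) • β j) (scalarTuple γ')) → c' ≤ c) ∧
      ∀ γ', InSpec A (dil Y (fun j => (c : ℂ) • β j) (scalarTuple γ')) →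
        ∑ j, γ' j ^ 2 ≤ ∑ j, γ j ^ 2 := by
  set S : Set (ℝ × (Fin g → ℝ)) :=
    {p | InSpec A (dil Y (fun j => (p.1 : ℂ) • β j) (scalarTuple p.2))} with hS
  have hSclosed : IsClosed S := hclosed.preimage (continuous_dil Y β)
  obtain ⟨j₀, a₀, ha₀⟩ : ∃ j a, β j a () ≠ 0 := by
    by_contra! h
    exact hβ0 (by funext j; ext a b; exact h j a)
  have hpos : 0 < ‖β j₀ a₀ ()‖ := norm_pos_iff.2 ha₀
  have hScomp : IsCompact S := by
    refine IsCompact.of_isClosed_subset (isCompact_Icc (a := (-(M / ‖β j₀ a₀ ()‖), fun _ => -M))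
      (b := (M / ‖β j₀ a₀ ()‖, fun _ => M))) hSclosed fun p hp => ?_
    have h1 : |p.1| ≤ M / ‖β j₀ a₀ ()‖ := by
      rw [le_div_iff₀ hpos]
      simpa [dil] using hbdd _ hp j₀ (Sum.inl a₀) (Sum.inr ())
    have h2 : ∀ j, |p.2 j| ≤ M := fun j => by
      simpa [dil, scalarTuple] using hbdd _ hp j (Sum.inr ()) (Sum.inr ())
    exact ⟨⟨(abs_le.1 h1).1, fun j => (abs_le.1 (h2 j)).1⟩,
      ⟨(abs_le.1 h1).2, fun j => (abs_le.1 (h2 j)).2⟩⟩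
  obtain ⟨t, ht, htS⟩ := hβ.exists_dil hA hY
  have htS' : (t, (0 : Fin g → ℝ)) ∈ S := by
    have h0 : scalarTuple (0 : Fin g → ℝ) = fun _ => 0 := by
      funext j; ext a b; simp [scalarTuple]
    simpa [hS, h0] using htS
  obtain ⟨p, hp, hpmax⟩ := hScomp.exists_isMaxOn ⟨_, htS'⟩ continuous_fst.continuousOn
  obtain ⟨q, hq, hqmax⟩ := (hScomp.inter_right
    (isClosed_singleton.preimage continuous_fst : IsClosed {q : ℝ × (Fin g → ℝ) | q.1 = p.1})
    ).exists_isMaxOn ⟨p, hp, rfl⟩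
    (f := fun q : ℝ × (Fin g → ℝ) => ∑ j, q.2 j ^ 2) (by fun_prop)
  have hqp : q.1 = p.1 := hq.2
  refine ⟨q.1, q.2, ?_, hq.1, fun c' γ' h => ?_, fun γ' h => ?_⟩
  · rw [hqp]
    exact ht.trans_le (hpmax htS')
  · rw [hqp]
    exact hpmax (show (c', γ') ∈ S from h)
  · exact hqmax (show (q.1, γ') ∈ S ∩ {q | q.1 = p.1} from ⟨h, hqp⟩)

lemma inclL_conjTranspose_mul_apply (M : Matrix (ι ⊕ Unit) κ ℂ) (a : ι) (b : κ) :
    ((inclL ι)ᴴ * M) a b = M (Sum.inl a) b := by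
  simp [inclL, Matrix.mul_apply, Fintype.sum_sum_type, one_apply]

/-- Restriction of dilation directions of a dilation to the original tuple. -/
def restrictDir {Y : Fin g → Matrix ι ι ℂ} {β : Fin g → Matrix ι Unit ℂ}
    {γ : Fin g → Matrix Unit Unit ℂ} (hY' : InSpec A (dil Y β γ)) :
    realDir A (dil Y β γ) →ₗ[ℝ] realDir A Y where
  toFun η := ⟨fun j => (inclL ι)ᴴ * η.1 j, by
    refine ⟨fun j a b => ?_, fun v hv => ?_⟩
    · change star (((inclL ι)ᴴ * η.1 j) a b) = ((inclL ι)ᴴ * η.1 j) a b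
      rw [inclL_conjTranspose_mul_apply]
      exact η.2.1 j (Sum.inl a) b
    · have h1 := (isComb_single inclL_inclL (dil Y β γ)).kernel (fun _ => hY') (v := v) (by
        simpa only [dil_compress] using hv) ()
      have h2 := η.2.2 _ h1
      rw [mulVec_mulVec, Lam_mul_amp] at h2
      simpa [conjTranspose_mul] using h2⟩
  map_add' η η' := by
    ext1; funext j
    simp [Matrix.mul_add]
  map_smul' c η := by
    ext1; funext j
    simp

lemma restrictDir_injective (hA : SATuple A) {Y : Fin g → Matrix ι ι ℂ}
    {β : Fin g → Matrix ι Unit ℂ} {γ : Fin g → ℝ} (hY' : InSpec A (dil Y β (scalarTuple γ)))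
    (hmax : ∀ γ', InSpec A (dil Y β (scalarTuple γ')) → ∑ j, γ' j ^ 2 ≤ ∑ j, γ j ^ 2) :
    Function.Injective (restrictDir hY') := by
  rw [← LinearMap.ker_eq_bot, LinearMap.ker_eq_bot']
  intro η hη
  have hL : ∀ j a b, η.1 j (Sum.inl a) b = 0 := fun j a b =>
    (inclL_conjTranspose_mul_apply (η.1 j) a b).symm.trans
      (congrFun (congrFun (congrFun (congrArg Subtype.val hη) j) a) b)
  set σ : Fin g → ℝ := fun j => (η.1 j (Sum.inr ()) ()).re with hσ
  have hR : ∀ j b, η.1 j (Sum.inr ()) b = σ j := fun j b =>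
    (Complex.conj_eq_iff_re.1 (η.2.1 j (Sum.inr ()) ())).symm
  set N : Fin g → Matrix (ι ⊕ Unit) (ι ⊕ Unit) ℂ :=
    dil (fun _ => 0) (fun _ => 0) (scalarTuple σ) with hN
  have hNη : N = fun j => inclR ι * (η.1 j)ᴴ := by
    funext j
    ext (a | a) (b | b) <;>
      simp [hN, dil, inclR, fromRows_mul, hL, hR, scalarTuple]
  have hNsa : SATuple N := fun j => by
    simp only [hN, dil, isHermitian_fromBlocks_iff]
    refine ⟨isHermitian_zero, by simp, by simp, ?_⟩
    ext a b
    simp [scalarTuple]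
  obtain ⟨t, ht, h1, h2⟩ := hY'.exists_perturbation hA hNsa (by
    intro v hv
    rw [hNη, ← amp_mul_Lam, ← mulVec_mulVec, η.2.2 v hv, mulVec_zero])
  have e1 : (fun j => dil Y β (scalarTuple γ) j + (t : ℂ) • N j) =
      dil Y β (scalarTuple fun j => γ j + t * σ j) := by
    funext j
    ext (a | a) (b | b) <;> simp [hN, dil, scalarTuple]
  have e2 : (fun j => dil Y β (scalarTuple γ) j - (t : ℂ) • N j) =
      dil Y β (scalarTuple fun j => γ j - t * σ j) := by
    funext j
    ext (a | a) (b | b) <;> simp [hN, dil, scalarTuple]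
  have h3 := hmax _ (e1 ▸ h1)
  have h4 := hmax _ (e2 ▸ h2)
  have h5 : ∑ j, (γ j + t * σ j) ^ 2 + ∑ j, (γ j - t * σ j) ^ 2 =
      2 * ∑ j, γ j ^ 2 + 2 * t ^ 2 * ∑ j, σ j ^ 2 := by
    rw [Finset.mul_sum, Finset.mul_sum, ← Finset.sum_add_distrib, ← Finset.sum_add_distrib]
    exact Finset.sum_congr rfl fun j _ => by ring
  have h6 : ∑ j, σ j ^ 2 = 0 := by
    refine le_antisymm ?_ (Finset.sum_nonneg fun j _ => sq_nonneg _)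
    by_contra! h
    have : 0 < 2 * t ^ 2 * ∑ j, σ j ^ 2 := by positivity
    linarith
  rw [Finset.sum_eq_zero_iff_of_nonneg fun j _ => sq_nonneg _] at h6
  ext1
  funext j
  ext (a | a) b
  · exact hL j a b
  · rw [hR, pow_eq_zero_iff two_ne_zero |>.1 (h6 j (Finset.mem_univ j))]
    simp

lemma not_dilDir_of_maximal (hA : SATuple A) {Y : Fin g → Matrix ι ι ℂ}
    {β : Fin g → Matrix ι Unit ℂ} {c : ℝ} (hc : 0 < c) {γ : Fin g → ℝ}
    (hY' : InSpec A (dil Y (fun j => (c : ℂ) • β j) (scalarTuple γ)))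
    (hmax : ∀ (c' : ℝ) γ', InSpec A (dil Y (fun j => (c' : ℂ) • β j) (scalarTuple γ')) → c' ≤ c)
    {η : Fin g → Matrix (ι ⊕ Unit) Unit ℂ}
    (hη : DilDir A (dil Y (fun j => (c : ℂ) • β j) (scalarTuple γ)) η)
    (hηβ : ∀ j, (inclL ι)ᴴ * η j = β j) : False := by
  obtain ⟨t, ht, hY''⟩ := hη.exists_dil hA hY'
  set Y' := dil Y (fun j => (c : ℂ) • β j) (scalarTuple γ) with hY'def
  set Z := dil Y' (fun j => (t : ℂ) • η j) fun _ => 0 with hZ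
  set r : ℝ := √(c ^ 2 + t ^ 2) with hr
  have hr2 : r ^ 2 = c ^ 2 + t ^ 2 := Real.sq_sqrt (by positivity)
  have hr0 : 0 < r := Real.sqrt_pos.2 (by positivity)
  have hrC : (r : ℂ) ≠ 0 := by exact_mod_cast hr0.ne'
  have hr2C : (r : ℂ) ^ 2 = (c : ℂ) ^ 2 + (t : ℂ) ^ 2 := by exact_mod_cast hr2
  set u : Matrix ((ι ⊕ Unit) ⊕ Unit) Unit ℂ :=
    ((c / r : ℝ) : ℂ) • (inclL (ι ⊕ Unit) * inclR ι) + ((t / r : ℝ) : ℂ) • inclR (ι ⊕ Unit)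
    with hu
  set F : Matrix ((ι ⊕ Unit) ⊕ Unit) (ι ⊕ Unit) ℂ :=
    inclL (ι ⊕ Unit) * inclL ι * (inclL ι)ᴴ + u * (inclR ι)ᴴ with hF
  have a1 : F * inclL ι = inclL (ι ⊕ Unit) * inclL ι := by
    simp [hF, Matrix.add_mul, Matrix.mul_assoc]
  have a2 : F * inclR ι = u := by
    simp [hF, Matrix.add_mul, Matrix.mul_assoc]
  have b1 : (inclL (ι ⊕ Unit) * inclL ι)ᴴ * (inclL (ι ⊕ Unit) * inclL ι) = 1 := by
    rw [conjTranspose_mul, Matrix.mul_assoc, ← Matrix.mul_assoc _ (inclL _) (inclL ι)]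
    simp
  have b2 : (inclL (ι ⊕ Unit) * inclL ι)ᴴ * u = 0 := by
    rw [conjTranspose_mul, Matrix.mul_assoc, hu, Matrix.mul_add, Matrix.mul_smul,
      ← Matrix.mul_assoc _ (inclL _) (inclR ι), Matrix.mul_smul]
    simp
  have b3 : uᴴ * u = 1 := by
    have d1 : (inclL (ι ⊕ Unit))ᴴ * u = ((c / r : ℝ) : ℂ) • inclR ι := by
      rw [hu, Matrix.mul_add, Matrix.mul_smul, ← Matrix.mul_assoc, Matrix.mul_smul]
      simp
    have d2 : (inclR (ι ⊕ Unit))ᴴ * u = ((t / r : ℝ) : ℂ) • 1 := by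
      rw [hu, Matrix.mul_add, Matrix.mul_smul, ← Matrix.mul_assoc, Matrix.mul_smul]
      simp
    conv_lhs => rw [hu]
    rw [← hu, conjTranspose_add, conjTranspose_smul, conjTranspose_smul, conjTranspose_mul,
      Matrix.add_mul, Matrix.smul_mul, Matrix.smul_mul, Matrix.mul_assoc, d1, d2, Matrix.mul_smul,
      inclR_inclR, smul_smul, smul_smul, ← add_smul]
    convert one_smul ℂ _
    simp only [Complex.star_def, Complex.conj_ofReal]
    push_cast
    field_simp
    exact hr2C.symm
  have hFF : Fᴴ * F = 1 := by
    have d1 : F = F * inclL ι * (inclL ι)ᴴ + F * inclR ι * (inclR ι)ᴴ := by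
      rw [Matrix.mul_assoc, Matrix.mul_assoc, ← Matrix.mul_add, incl_add_incl, Matrix.mul_one]
    have b2' := congrArg conjTranspose b2
    rw [conjTranspose_mul, conjTranspose_conjTranspose, conjTranspose_zero] at b2'
    rw [d1, a1, a2, conjTranspose_add, conjTranspose_mul, conjTranspose_mul _ (inclR ι)ᴴ,
      conjTranspose_conjTranspose, conjTranspose_conjTranspose]
    set p := inclL (ι ⊕ Unit) * inclL ι
    have d2 : (inclL ι * pᴴ + inclR ι * uᴴ) * (p * (inclL ι)ᴴ + u * (inclR ι)ᴴ) =
        inclL ι * (pᴴ * p) * (inclL ι)ᴴ + inclR ι * (uᴴ * p) * (inclL ι)ᴴ +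
        (inclL ι * (pᴴ * u) * (inclR ι)ᴴ + inclR ι * (uᴴ * u) * (inclR ι)ᴴ) := by
      simp only [Matrix.mul_add, Matrix.add_mul, Matrix.mul_assoc]
    rw [d2, b1, b2, b3, b2']
    simpa using incl_add_incl
  have hX := hY''.compress_s1 hFF
  rw [eq_dil_of_isHermitian hX.1] at hX
  have e1 : ∀ j, (inclL ι)ᴴ * (Fᴴ * Z j * F) * inclL ι = Y j := fun j => by
    have : (inclL ι)ᴴ * (Fᴴ * Z j * F) * inclL ι = (F * inclL ι)ᴴ * Z j * (F * inclL ι) := by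
      simp only [conjTranspose_mul, Matrix.mul_assoc]
    rw [this, a1]
    have : (inclL (ι ⊕ Unit) * inclL ι)ᴴ * Z j * (inclL (ι ⊕ Unit) * inclL ι) =
        (inclL ι)ᴴ * ((inclL (ι ⊕ Unit))ᴴ * Z j * inclL (ι ⊕ Unit)) * inclL ι := by
      simp only [conjTranspose_mul, Matrix.mul_assoc]
    rw [this, hZ, dil_compress, hY'def, dil_compress]
  have e2 : ∀ j, (inclL ι)ᴴ * (Fᴴ * Z j * F) * inclR ι = (r : ℂ) • β j := fun j => by
    have d1 : (inclL ι)ᴴ * (Fᴴ * Z j * F) * inclR ι = (F * inclL ι)ᴴ * Z j * (F * inclR ι) := by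
      simp only [conjTranspose_mul, Matrix.mul_assoc]
    have d2 : (inclL (ι ⊕ Unit) * inclL ι)ᴴ * Z j * u =
        ((c / r : ℝ) : ℂ) •
          ((inclL ι)ᴴ * ((inclL (ι ⊕ Unit))ᴴ * Z j * inclL (ι ⊕ Unit)) * inclR ι) +
        ((t / r : ℝ) : ℂ) • ((inclL ι)ᴴ * ((inclL (ι ⊕ Unit))ᴴ * Z j * inclR (ι ⊕ Unit))) := by
      rw [hu]
      simp only [conjTranspose_mul, Matrix.mul_assoc, Matrix.mul_add, Matrix.mul_smul]
    rw [d1, a1, a2, d2, hZ, dil_compress, dil_corner, hY'def, dil_corner, Matrix.mul_smul, hηβ,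
      smul_smul, smul_smul, ← add_smul]
    congr 1
    push_cast
    field_simp
    exact hr2C.symm
  have e3 : ∀ j, ((inclR ι)ᴴ * (Fᴴ * Z j * F) * inclR ι).IsHermitian := fun j => by
    have := (hY''.1 j).eq
    simp only [IsHermitian, conjTranspose_mul, conjTranspose_conjTranspose, Matrix.mul_assoc, this]
  rw [eq_scalarTuple e3, funext e1, funext e2] at hX
  have := hmax r _ hX
  nlinarith

lemma exists_dil_finrank_lt (hA : SATuple A) {M : ℝ}
    (hbdd : ∀ X : Fin g → Matrix (ι ⊕ Unit) (ι ⊕ Unit) ℂ, InSpec A X → ∀ j a b, ‖X j a b‖ ≤ M)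
    (hclosed : IsClosed {X : Fin g → Matrix (ι ⊕ Unit) (ι ⊕ Unit) ℂ | InSpec A X})
    {Y : Fin g → Matrix ι ι ℂ} (hY : InSpec A Y) (hYr : IsRealTuple Y) (h : realDir A Y ≠ ⊥) :
    ∃ Y' : Fin g → Matrix (ι ⊕ Unit) (ι ⊕ Unit) ℂ, InSpec A Y' ∧ IsRealTuple Y' ∧
      (∀ j, (inclL ι)ᴴ * Y' j * inclL ι = Y j) ∧
      Module.finrank ℝ (realDir A Y') < Module.finrank ℝ (realDir A Y) := by
  obtain ⟨β, hβ, hβ0⟩ := (Submodule.ne_bot_iff _).1 h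
  obtain ⟨c, γ, hc, hY', hmax, hmax'⟩ := exists_maximal_dil hA hbdd hclosed hY hβ.2 hβ0
  refine ⟨_, hY', isRealTuple_dil hYr (fun j a b => ?_) γ, fun j => dil_compress _ _ _ j, ?_⟩
  · have := hβ.1 j a b
    simp_all
  · have hinj := restrictDir_injective hA hY' hmax'
    refine lt_of_le_of_ne (LinearMap.finrank_le_finrank_of_injective hinj) fun heq => ?_
    obtain ⟨η, hη⟩ := (LinearMap.injective_iff_surjective_of_finrank_eq_finrank heq).1 hinj ⟨β, hβ⟩
    exact not_dilDir_of_maximal hA hc hY' hmax η.2.2 (congrFun (congrArg Subtype.val hη))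

end Descent

section Transfer

variable {g d : ℕ} {ι κ : Type} {A : Fin g → Matrix (Fin d) (Fin d) ℂ}
  [Fintype ι] [DecidableEq ι] [Fintype κ] [DecidableEq κ]

lemma _root_.InSpec.submatrix {X : Fin g → Matrix κ κ ℂ} (h : InSpec A X) (e : ι ≃ κ) :
    InSpec A fun j => (X j).submatrix e e := by
  refine ⟨fun j => (h.1 j).submatrix e, ?_⟩
  have h1 : LPencil A (fun j => (X j).submatrix e e) =
      (LPencil A X).submatrix (Prod.map id e) (Prod.map id e) := by
    ext ⟨a, b⟩ ⟨c, f⟩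
    simp [LPencil, Lam, Matrix.sum_apply, kroneckerMap_apply, one_apply]
  rw [h1]
  exact h.2.submatrix _

lemma inSpec_submatrix_iff {X : Fin g → Matrix κ κ ℂ} (e : ι ≃ κ) :
    InSpec A (fun j => (X j).submatrix e e) ↔ InSpec A X :=
  ⟨fun h => by simpa using h.submatrix e.symm, fun h => h.submatrix e⟩

lemma exists_entry_bound
    (hbdd : ∃ C : ℝ, 0 < C ∧ ∀ (m : ℕ) (X : Fin g → Matrix (Fin m) (Fin m) ℂ),
      InSpec A X → ((C : ℂ) • (1 : Matrix (Fin m) (Fin m) ℂ) - ∑ j, X j * X j).PosSemidef) :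
    ∃ M : ℝ, ∀ (ι : Type) [Fintype ι] [DecidableEq ι] (X : Fin g → Matrix ι ι ℂ),
      InSpec A X → ∀ j a b, ‖X j a b‖ ≤ M := by
  obtain ⟨C, hC, h⟩ := hbdd
  have key : ∀ (m : ℕ) (X : Fin g → Matrix (Fin m) (Fin m) ℂ), InSpec A X →
      ∀ j a b, ‖X j a b‖ ≤ √C := by
    intro m X hX j a b
    have h1 := (h m X hX).diag_nonneg (i := a)
    have h2 : ∀ j k, X j a k * X j k a = ((‖X j a k‖ ^ 2 : ℝ) : ℂ) := fun j k => by
      rw [← (hX.1 j).apply k a, Complex.star_def, Complex.mul_conj']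
      push_cast
      rfl
    simp only [Matrix.sub_apply, Matrix.smul_apply, one_apply_eq, Matrix.sum_apply, Matrix.mul_apply, h2,
      smul_eq_mul, mul_one] at h1
    have h3 : 0 ≤ C - ∑ j, ∑ k, ‖X j a k‖ ^ 2 := by exact_mod_cast h1
    refine Real.le_sqrt_of_sq_le ?_
    have h4 := Finset.single_le_sum (f := fun k => ‖X j a k‖ ^ 2) (fun _ _ => sq_nonneg _)
      (Finset.mem_univ b)
    have h5 := Finset.single_le_sum (f := fun j => ∑ k, ‖X j a k‖ ^ 2)
      (fun _ _ => Finset.sum_nonneg fun _ _ => sq_nonneg _) (Finset.mem_univ j)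
    linarith
  refine ⟨√C, fun ι _ _ X hX j a b => ?_⟩
  simpa using key _ _ (hX.submatrix (Fintype.equivFin ι).symm) j (Fintype.equivFin ι a)
    (Fintype.equivFin ι b)

variable (ι) in
lemma isClosed_inSpec
    (hclosed : ∀ m : ℕ, IsClosed {X : Fin g → Matrix (Fin m) (Fin m) ℂ | InSpec A X}) :
    IsClosed {X : Fin g → Matrix ι ι ℂ | InSpec A X} := by
  set e := (Fintype.equivFin ι).symm
  have h1 : {X : Fin g → Matrix ι ι ℂ | InSpec A X} =
      (fun X : Fin g → Matrix ι ι ℂ => fun j => (X j).submatrix e e) ⁻¹' {X | InSpec A X} := by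
    ext X
    exact (inSpec_submatrix_iff e).symm
  rw [h1]
  exact (hclosed _).preimage (continuous_pi fun j => (continuous_apply j).matrix_submatrix _ _)

lemma _root_.InSpec.conj
    (hconj : ∀ (m : ℕ) (X : Fin g → Matrix (Fin m) (Fin m) ℂ),
      InSpec A X → InSpec A fun j => (X j).map (starRingEnd ℂ))
    {X : Fin g → Matrix ι ι ℂ} (hX : InSpec A X) :
    InSpec A fun j => (X j).map (starRingEnd ℂ) := by
  have := (hconj _ _ (hX.submatrix (Fintype.equivFin ι).symm)).submatrix (Fintype.equivFin ι)
  convert this using 1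
  funext j
  ext a b
  simp

end Transfer

section RealDilation

variable {g d : ℕ} {ι κ : Type} {A : Fin g → Matrix (Fin d) (Fin d) ℂ}

/-- Every real point dilates to a real point without real dilation directions. -/
lemma exists_real_dilation (hA : SATuple A)
    (hbdd : ∃ C : ℝ, 0 < C ∧ ∀ (m : ℕ) (X : Fin g → Matrix (Fin m) (Fin m) ℂ),
      InSpec A X → ((C : ℂ) • (1 : Matrix (Fin m) (Fin m) ℂ) - ∑ j, X j * X j).PosSemidef)
    (hclosed : ∀ m : ℕ, IsClosed {X : Fin g → Matrix (Fin m) (Fin m) ℂ | InSpec A X})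
    (N : ℕ) : ∀ (ι : Type) [Fintype ι] [DecidableEq ι] (Y : Fin g → Matrix ι ι ℂ), InSpec A Y →
      IsRealTuple Y → Module.finrank ℝ (realDir A Y) ≤ N →
      ∃ (κ : Type) (_ : Fintype κ) (_ : DecidableEq κ) (Z : Fin g → Matrix κ κ ℂ)
        (V : Matrix κ ι ℂ), InSpec A Z ∧ IsRealTuple Z ∧ realDir A Z = ⊥ ∧ Vᴴ * V = 1 ∧
        ∀ j, Vᴴ * Z j * V = Y j := by
  obtain ⟨M, hM⟩ := exists_entry_bound hbdd
  induction N with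
  | zero =>
    intro ι _ _ Y hY hYr hN
    exact ⟨ι, _, _, Y, 1, hY, hYr, Submodule.finrank_eq_zero.1 (Nat.le_zero.1 hN), by simp,
      by simp⟩
  | succ N ih =>
    intro ι _ _ Y hY hYr hN
    by_cases h : realDir A Y = ⊥
    · exact ⟨ι, _, _, Y, 1, hY, hYr, h, by simp, by simp⟩
    obtain ⟨Y', hY', hYr', hYY', hlt⟩ := exists_dil_finrank_lt hA (fun X hX => hM _ X hX)
      (isClosed_inSpec _ hclosed) hY hYr h
    obtain ⟨κ, i1, i2, Z, V, hZ, hZr, hZ0, hV, hVZ⟩ := ih _ Y' hY' hYr' (by omega)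
    refine ⟨κ, i1, i2, Z, V * inclL ι, hZ, hZr, hZ0, ?_, fun j => ?_⟩
    · rw [conjTranspose_mul, Matrix.mul_assoc, ← Matrix.mul_assoc _ V, hV, Matrix.one_mul,
        inclL_inclL]
    · rw [← hYY', ← hVZ]
      simp only [conjTranspose_mul, Matrix.mul_assoc]

variable [Fintype ι] [DecidableEq ι]

lemma arveson_of_realDir_eq_bot (hA : SATuple A)
    (hconj : ∀ (m : ℕ) (X : Fin g → Matrix (Fin m) (Fin m) ℂ),
      InSpec A X → InSpec A fun j => (X j).map (starRingEnd ℂ))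
    {Z : Fin g → Matrix ι ι ℂ} (hZ : InSpec A Z) (hZr : IsRealTuple Z) (h : realDir A Z = ⊥) :
    Arveson A Z := by
  intro β hβ
  obtain ⟨t, ht, hD⟩ := hβ.exists_dil hA hZ
  have htC : (t : ℂ) ≠ 0 := by exact_mod_cast ht.ne'
  have hβ' : DilDir A Z fun j => (β j).map (starRingEnd ℂ) := by
    have h1 := hD.conj hconj
    have h2 : (fun j => (dil Z (fun j => (t : ℂ) • β j) (fun _ => 0) j).map (starRingEnd ℂ)) =
        dil Z (fun j => (t : ℂ) • (β j).map (starRingEnd ℂ)) fun _ => 0 := by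
      funext j
      ext (a | a) (b | b)
      · exact hZr j a b
      · simp [dil]
      · simp [dil]
      · simp [dil]
    rw [h2] at h1
    have h3 := h1.dilDir.smul (t : ℂ)⁻¹
    simpa only [smul_smul, inv_mul_cancel₀ htC, one_smul] using h3
  have e1 : (fun j => β j + (β j).map (starRingEnd ℂ)) ∈ realDir A Z :=
    ⟨fun j a b => by simp [add_comm], hβ.add hβ'⟩
  have e2 : (fun j => Complex.I • (β j + (-1 : ℂ) • (β j).map (starRingEnd ℂ))) ∈ realDir A Z :=
    ⟨fun j a b => by simp; ring, (hβ.add (hβ'.smul (-1))).smul Complex.I⟩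
  rw [h, Submodule.mem_bot] at e1 e2
  funext j
  ext a b
  have f1 := congrFun (congrFun (congrFun e1 j) a) b
  have f2 := congrFun (congrFun (congrFun e2 j) a) b
  simp at f1 f2
  have : 2 * β j a b = 0 := by linear_combination f1 + f2
  simpa using this

/-- Every point of a conjugation-closed spectrahedron compresses a real point. -/
lemma _root_.InSpec.exists_real
    (hconj : ∀ (m : ℕ) (X : Fin g → Matrix (Fin m) (Fin m) ℂ),
      InSpec A X → InSpec A fun j => (X j).map (starRingEnd ℂ))
    {X : Fin g → Matrix ι ι ℂ} (hX : InSpec A X) :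
    ∃ (R : Fin g → Matrix (ι ⊕ ι) (ι ⊕ ι) ℂ) (V : Matrix (ι ⊕ ι) ι ℂ), InSpec A R ∧
      IsRealTuple R ∧ Vᴴ * V = 1 ∧ ∀ j, Vᴴ * R j * V = X j := by
  set s : ℂ := (((√2)⁻¹ : ℝ) : ℂ) with hs
  have hss : s * s = 1 / 2 := by
    rw [hs, ← Complex.ofReal_mul, ← mul_inv, Real.mul_self_sqrt zero_le_two]
    norm_num
  have hsc : star s = s := by simp [hs]
  have h2 : s * s * 2 = 1 := by rw [hss]; norm_num
  set V : Matrix (ι ⊕ ι) ι ℂ := fromRows (s • 1) ((-(Complex.I * s)) • 1) with hV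
  set W : Matrix (ι ⊕ ι) ι ℂ := fromRows (s • 1) ((Complex.I * s) • 1) with hW
  have hVH : Vᴴ = fromCols (s • 1) ((Complex.I * s) • 1) := by
    simp [hV, conjTranspose_fromRows_eq_fromCols_conjTranspose, conjTranspose_smul, hsc,
      -Complex.star_def]
  have hWH : Wᴴ = fromCols (s • 1) ((-(Complex.I * s)) • 1) := by
    simp [hW, conjTranspose_fromRows_eq_fromCols_conjTranspose, conjTranspose_smul, hsc,
      -Complex.star_def]
  have hVV : Vᴴ * V = 1 := by
    rw [hVH, hV, fromCols_mul_fromRows]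
    simp only [smul_mul_smul_comm, Matrix.mul_one, ← add_smul]
    convert one_smul ℂ _
    linear_combination h2 - s * s * Complex.I_sq
  have hVW : Vᴴ * W = 0 := by
    rw [hVH, hW, fromCols_mul_fromRows]
    simp only [smul_mul_smul_comm, Matrix.mul_one, ← add_smul]
    convert zero_smul ℂ _
    linear_combination s * s * Complex.I_sq
  have hWV : Wᴴ * V = 0 := by
    have := congrArg conjTranspose hVW
    simpa using this
  have h1 : Vᴴᴴ * Vᴴ + Wᴴᴴ * Wᴴ = 1 := by
    rw [conjTranspose_conjTranspose, conjTranspose_conjTranspose, hVH, hWH, hV, hW,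
      fromRows_mul_fromCols, fromRows_mul_fromCols, fromBlocks_add, ← fromBlocks_one]
    simp only [smul_mul_smul_comm, Matrix.mul_one, ← add_smul]
    congr 1
    · convert one_smul ℂ _
      linear_combination h2
    · convert zero_smul ℂ _
      ring
    · convert zero_smul ℂ _
      ring
    · convert one_smul ℂ _
      linear_combination h2 - 2 * s * s * Complex.I_sq
  refine ⟨_, V, InSpec.comb_two h1 hX (hX.conj hconj), fun j => ?_, hVV, fun j => ?_⟩
  · rw [conjTranspose_conjTranspose, conjTranspose_conjTranspose, hVH, hWH, hV, hW]
    rintro (a | a) (b | b) <;>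
    simp [fromRows_mul, mul_fromCols, hsc, -Complex.star_def] <;> ring
  · rw [conjTranspose_conjTranspose, conjTranspose_conjTranspose, Matrix.mul_add, Matrix.add_mul]
    simp only [← Matrix.mul_assoc, hVV, hVW]
    simp [Matrix.mul_assoc, hVV]

end RealDilation

section Irreducible

variable {g d : ℕ} {ι κ μ : Type} {A : Fin g → Matrix (Fin d) (Fin d) ℂ}
  [Fintype ι] [DecidableEq ι] [Fintype κ] [DecidableEq κ] [Fintype μ] [DecidableEq μ]

lemma Arveson.of_intertwine {V : Matrix κ ι ℂ} (hV : Vᴴ * V = 1) {Z : Fin g → Matrix κ κ ℂ}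
    {Y : Fin g → Matrix ι ι ℂ} (hZ : Arveson A Z) (h : ∀ j, Vᴴ * Z j = Y j * Vᴴ) :
    Arveson A Y := by
  intro β hβ
  have h1 : DilDir A Z fun j => V * β j := by
    intro v hv
    have e1 := congrArg (amp d Vᴴ *ᵥ ·) hv
    simp only [mulVec_mulVec, mulVec_zero, amp_mul_LPencil, h] at e1
    rw [← LPencil_mul_amp, ← mulVec_mulVec] at e1
    have e2 := hβ _ e1
    rw [mulVec_mulVec, Lam_mul_amp] at e2
    simpa only [conjTranspose_mul] using e2
  funext j
  have h2 := congrArg (Vᴴ * ·) (congrFun (hZ _ h1) j)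
  simpa [← Matrix.mul_assoc, hV] using h2

lemma exists_isometry_complement {V : Matrix κ ι ℂ} (hV : Vᴴ * V = 1) :
    ∃ (ℓ : ℕ) (W : Matrix κ (Fin ℓ) ℂ), Fintype.card κ = Fintype.card ι + ℓ ∧ Wᴴ * W = 1 ∧
      Vᴴ * W = 0 ∧ V * Vᴴ + W * Wᴴ = 1 := by
  set v₀ : ι → EuclideanSpace ℂ κ := fun i => WithLp.toLp 2 fun k => V k i with hv₀
  have horth : Orthonormal ℂ v₀ := by
    rw [orthonormal_iff_ite]
    intro i j
    have := congrFun (congrFun hV i) j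
    rw [one_apply] at this
    rw [← this]
    simp [hv₀, PiLp.inner_apply, Matrix.mul_apply, mul_comm]
  have hcard : Fintype.card ι ≤ Fintype.card κ := by
    simpa using horth.linearIndependent.fintype_card_le_finrank
  obtain ⟨ℓ, hℓ⟩ := Nat.exists_eq_add_of_le hcard
  obtain ⟨b, hb⟩ := Orthonormal.exists_orthonormalBasis_extension_of_card_eq (𝕜 := ℂ)
    (E := EuclideanSpace ℂ κ) (ι := ι ⊕ Fin ℓ) (by simp [hℓ]) (v := Sum.elim v₀ 0)
    (s := Set.range Sum.inl) (by
      rw [orthonormal_iff_ite] at horth ⊢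
      rintro ⟨_, i, rfl⟩ ⟨_, j, rfl⟩
      simpa [Subtype.ext_iff] using horth i j)
  have hb' : ∀ i, b (Sum.inl i) = v₀ i := fun i => hb _ ⟨i, rfl⟩
  set W : Matrix κ (Fin ℓ) ℂ := of fun k i => b (Sum.inr i) k with hW
  have h1 : (fromCols V W)ᴴ * fromCols V W = 1 := by
    ext x y
    have h2 : ∀ k x, fromCols V W k x = b x k := by
      rintro k (i | i)
      · simp [hb', hv₀]
      · simp [hW]
    have h3 := orthonormal_iff_ite.1 b.orthonormal x y
    rw [one_apply, ← h3]
    simp [Matrix.mul_apply, h2, PiLp.inner_apply, mul_comm]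
  have h2 : fromCols V W * (fromCols V W)ᴴ = 1 :=
    (mul_eq_one_comm_of_card_eq _ _ _ (by simp [hℓ])).1 h1
  rw [conjTranspose_fromCols_eq_fromRows_conjTranspose] at h1 h2
  rw [fromCols_mul_fromRows] at h2
  rw [fromRows_mul_fromCols, ← fromBlocks_one, fromBlocks_inj] at h1
  exact ⟨ℓ, W, hℓ, h1.2.2.2, h1.2.1, h2⟩

/-- An irreducible point with trivial dilation subspace is absolutely extreme. -/
lemma isAbsExt_of_arveson {m : ℕ} {X : Fin g → Matrix (Fin m) (Fin m) ℂ} (hX : InSpec A X)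
    (hXA : Arveson A X)
    (hirr : ∀ H : Matrix (Fin m) (Fin m) ℂ, H.IsHermitian → (∀ j, H * X j = X j * H) →
      ∃ c : ℂ, H = c • (1 : Matrix (Fin m) (Fin m) ℂ)) :
    IsAbsExt (fun ℓ => {W : Fin g → Matrix (Fin ℓ) (Fin ℓ) ℂ | InSpec A W}) X := by
  refine ⟨hX, fun k nn Y V hY hV hsum hXY i => ?_⟩
  have hcomb : IsComb Y V X := ⟨hsum, hXY⟩
  have hint := hcomb.intertwine hY hXA i
  obtain ⟨c, hc⟩ := hirr ((V i)ᴴ * V i) (isHermitian_conjTranspose_mul_self _) fun j => by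
    have h1 := congrArg conjTranspose (hint j)
    rw [conjTranspose_mul, conjTranspose_mul, ((hY i).1 j).eq, (hX.1 j).eq] at h1
    rw [Matrix.mul_assoc, ← hint, ← Matrix.mul_assoc, ← Matrix.mul_assoc, h1]
  obtain ⟨r, hr, hrc⟩ : ∃ r : ℝ, 0 < r ∧ c = (r : ℂ) * r := by
    obtain ⟨a, b, hab⟩ : ∃ a b, V i a b ≠ 0 := by
      by_contra! h
      exact hV i (by ext a b; exact h a b)
    have h1 := (posSemidef_conjTranspose_mul_self (V i)).diag_nonneg (i := b)
    rw [hc] at h1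
    have h1 : 0 ≤ c := by simpa using h1
    have h2 : c ≠ 0 := by
      rintro rfl
      exact hV i (conjTranspose_mul_self_eq_zero.1 (by simpa using hc))
    obtain ⟨h3, h4⟩ := Complex.nonneg_iff.1 h1
    have h5 : c = (c.re : ℂ) := Complex.ext rfl (by simpa using h4.symm)
    have h6 : 0 < c.re := lt_of_le_of_ne h3 fun h => h2 (by rw [h5, ← h]; simp)
    refine ⟨√c.re, Real.sqrt_pos.2 h6, ?_⟩
    rw [← Complex.ofReal_mul, Real.mul_self_sqrt h3, ← h5]
  have hrC : (r : ℂ) ≠ 0 := by exact_mod_cast hr.ne'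
  set U : Matrix (Fin (nn i)) (Fin m) ℂ := (r : ℂ)⁻¹ • V i with hU
  have hUU : Uᴴ * U = 1 := by
    rw [hU, conjTranspose_smul, Matrix.smul_mul, Matrix.mul_smul, hc, hrc, smul_smul, smul_smul]
    convert one_smul ℂ _
    simp
    field_simp
  have hYU : ∀ j, Y i j * U = U * X j := fun j => by
    rw [hU, Matrix.mul_smul, hint, Matrix.smul_mul]
  have hUY : ∀ j, Uᴴ * Y i j = X j * Uᴴ := fun j => by
    have h1 := congrArg conjTranspose (hYU j)
    rwa [conjTranspose_mul, conjTranspose_mul, ((hY i).1 j).eq, (hX.1 j).eq] at h1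
  obtain ⟨ℓ, W, hℓ, hWW, hUW, hsum'⟩ := exists_isometry_complement hUU
  simp only [Fintype.card_fin] at hℓ
  obtain rfl | hℓ0 := Nat.eq_zero_or_pos ℓ
  · left
    have hUU' : U * Uᴴ = 1 := by
      rw [← hsum', left_eq_add]
      ext a b
      simp [Matrix.mul_apply]
    refine ⟨hℓ, Uᴴ, by simpa using hUU', by simpa using hUU, fun j => ?_⟩
    rw [conjTranspose_conjTranspose, ← hYU, Matrix.mul_assoc, hUU', Matrix.mul_one]
  · right
    refine ⟨by omega, ℓ, fun j => Wᴴ * Y i j * W, (hY i).compress_s1 hWW, fromRows Uᴴ Wᴴ, ?_, ?_,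
      fun j => ?_⟩
    · simpa [conjTranspose_fromRows_eq_fromCols_conjTranspose, fromCols_mul_fromRows] using hsum'
    · have hWU : Wᴴ * U = 0 := by simpa using congrArg conjTranspose hUW
      simp [conjTranspose_fromRows_eq_fromCols_conjTranspose, hUU, hUW, hWU, hWW]
    · have h1 : W * (Wᴴ * Y i j * W) = Y i j * W := by
        have h2 : U * (Uᴴ * (Y i j * W)) = 0 := by
          rw [← Matrix.mul_assoc Uᴴ, hUY, Matrix.mul_assoc (X j), hUW]
          simp
        have h3 := congrArg (· * (Y i j * W)) hsum'
        simp only [Matrix.add_mul, Matrix.one_mul, Matrix.mul_assoc, h2, zero_add] at h3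
        simpa only [Matrix.mul_assoc] using h3
      simp only [conjTranspose_fromRows_eq_fromCols_conjTranspose, conjTranspose_conjTranspose,
        fromCols_mul_fromBlocks, Matrix.mul_zero, zero_add, add_zero, fromCols_mul_fromRows, h1,
        ← hYU]
      rw [Matrix.mul_assoc, Matrix.mul_assoc, ← Matrix.mul_add, hsum', Matrix.mul_one]

end Irreducible

section Hull

variable {g d : ℕ} {ι κ μ : Type} {A : Fin g → Matrix (Fin d) (Fin d) ℂ}
  [Fintype ι] [DecidableEq ι] [Fintype κ] [DecidableEq κ] [Fintype μ] [DecidableEq μ]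

/-- `X` is a matrix convex combination of absolute extreme points. -/
def AbsHull (A : Fin g → Matrix (Fin d) (Fin d) ℂ) (X : Fin g → Matrix ι ι ℂ) : Prop :=
  ∃ (s : Type) (_ : Fintype s) (ℓ : s → ℕ)
    (Y : ∀ i, Fin g → Matrix (Fin (ℓ i)) (Fin (ℓ i)) ℂ) (V : ∀ i, Matrix (Fin (ℓ i)) ι ℂ),
    (∀ i, IsAbsExt (fun ℓ => {W : Fin g → Matrix (Fin ℓ) (Fin ℓ) ℂ | InSpec A W}) (Y i)) ∧
    IsComb Y V X

lemma absHull_of_isAbsExt {m : ℕ} {X : Fin g → Matrix (Fin m) (Fin m) ℂ}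
    (h : IsAbsExt (fun ℓ => {W : Fin g → Matrix (Fin ℓ) (Fin ℓ) ℂ | InSpec A W}) X) :
    AbsHull A X :=
  ⟨Unit, inferInstance, fun _ => m, fun _ => X, fun _ => 1, fun _ => h, by simp [IsComb]⟩

lemma AbsHull.compress_s1 {V : Matrix κ ι ℂ} (hV : Vᴴ * V = 1) {X : Fin g → Matrix κ κ ℂ}
    (hX : AbsHull A X) : AbsHull A fun j => Vᴴ * X j * V := by
  obtain ⟨s, hs, ℓ, Y, W, hY, h1, h2⟩ := hX
  refine ⟨s, hs, ℓ, Y, fun i => W i * V, hY, ?_, fun j => ?_⟩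
  · have := congrArg (fun M => Vᴴ * M * V) h1
    simpa only [Matrix.mul_sum, Matrix.sum_mul, Matrix.mul_one, hV, conjTranspose_mul,
      Matrix.mul_assoc] using this
  · simp only [h2, Matrix.mul_sum, Matrix.sum_mul, conjTranspose_mul, Matrix.mul_assoc]

lemma AbsHull.comb_two {V : Matrix κ ι ℂ} {W : Matrix μ ι ℂ} (h : Vᴴ * V + Wᴴ * W = 1)
    {X : Fin g → Matrix κ κ ℂ} {X' : Fin g → Matrix μ μ ℂ} (hX : AbsHull A X)
    (hX' : AbsHull A X') : AbsHull A fun j => Vᴴ * X j * V + Wᴴ * X' j * W := by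
  obtain ⟨s, hs, ℓ, Y, U, hY, h1, h2⟩ := hX
  obtain ⟨s', hs', ℓ', Y', U', hY', h1', h2'⟩ := hX'
  refine ⟨s ⊕ s', inferInstance, Sum.elim ℓ ℓ', Sum.rec Y Y',
    Sum.rec (fun i => U i * V) (fun i => U' i * W), ?_, ?_, fun j => ?_⟩
  · rintro (i | i)
    · exact hY i
    · exact hY' i
  · rw [Fintype.sum_sum_type, ← h]
    congr 1
    · change ∑ i, (U i * V)ᴴ * (U i * V) = _
      have := congrArg (fun M => Vᴴ * M * V) h1
      simpa only [Matrix.mul_sum, Matrix.sum_mul, Matrix.mul_one, conjTranspose_mul,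
        Matrix.mul_assoc] using this
    · change ∑ i, (U' i * W)ᴴ * (U' i * W) = _
      have := congrArg (fun M => Wᴴ * M * W) h1'
      simpa only [Matrix.mul_sum, Matrix.sum_mul, Matrix.mul_one, conjTranspose_mul,
        Matrix.mul_assoc] using this
  · rw [Fintype.sum_sum_type]
    change _ = ∑ i, (U i * V)ᴴ * Y i j * (U i * V) + ∑ i, (U' i * W)ᴴ * Y' i j * (U' i * W)
    simp only [h2, h2', Matrix.mul_sum, Matrix.sum_mul, conjTranspose_mul, Matrix.mul_assoc]

/-- A Hermitian matrix commuting with a tuple either is scalar or splits the tuple. -/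
lemma exists_split {m : ℕ} {Z : Fin g → Matrix (Fin m) (Fin m) ℂ}
    {H : Matrix (Fin m) (Fin m) ℂ} (hH : H.IsHermitian) (hHZ : ∀ j, H * Z j = Z j * H)
    (hne : ∀ c : ℂ, H ≠ c • (1 : Matrix (Fin m) (Fin m) ℂ)) :
    ∃ (p q : ℕ) (V : Matrix (Fin m) (Fin p) ℂ) (W : Matrix (Fin m) (Fin q) ℂ), p < m ∧ q < m ∧
      Vᴴ * V = 1 ∧ Wᴴ * W = 1 ∧ V * Vᴴ + W * Wᴴ = 1 ∧ (∀ j, Vᴴ * Z j * W = 0) ∧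
      ∀ j, Wᴴ * Z j * V = 0 := by
  obtain ⟨U, h, hU, hU', hHU⟩ := exists_unitary_diagonalization hH
  obtain ⟨i₀, i₁, hi⟩ : ∃ i₀ i₁, h i₀ ≠ h i₁ := by
    by_contra! hcon
    obtain ⟨c, hc⟩ : ∃ c, ∀ i, h i = c := by
      obtain he | ⟨⟨i⟩⟩ := isEmpty_or_nonempty (Fin m)
      · exact ⟨0, fun i => he.elim i⟩
      · exact ⟨h i, fun k => hcon k i⟩
    refine hne c ?_
    rw [hHU]
    simp only [hc, ← smul_one_eq_diagonal]
    simp [hU']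
  have hoff : ∀ j a b, h a ≠ h b → (Uᴴ * Z j * U) a b = 0 := by
    intro j a b hab
    have h1 : diagonal (fun i => (h i : ℂ)) * (Uᴴ * Z j * U) =
        (Uᴴ * Z j * U) * diagonal fun i => (h i : ℂ) := by
      have h2 := congrArg (fun M => Uᴴ * M * U) (hHZ j)
      rw [hHU] at h2
      have h3 : Uᴴ * (U * diagonal (fun i => (h i : ℂ)) * Uᴴ * Z j) * U =
          (Uᴴ * U) * (diagonal (fun i => (h i : ℂ)) * (Uᴴ * Z j * U)) := by
        simp only [Matrix.mul_assoc]
      have h4 : Uᴴ * (Z j * (U * diagonal (fun i => (h i : ℂ)) * Uᴴ)) * U =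
          ((Uᴴ * Z j * U) * diagonal fun i => (h i : ℂ)) * (Uᴴ * U) := by
        simp only [Matrix.mul_assoc]
      simpa only [h3, h4, hU, Matrix.one_mul, Matrix.mul_one] using h2
    have h2 := congrFun (congrFun h1 a) b
    rw [diagonal_mul, mul_diagonal, mul_comm, ← sub_eq_zero, ← mul_sub] at h2
    refine (mul_eq_zero.1 h2).resolve_right ?_
    exact sub_ne_zero.2 (by exact_mod_cast hab)
  classical
  set e₁ := (Fintype.equivFin {i // h i = h i₀}).symm
  set e₂ := (Fintype.equivFin {i // ¬ h i = h i₀}).symm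
  set e := (Equiv.sumCongr e₁ e₂).trans (Equiv.sumCompl fun i => h i = h i₀)
  set V := U.submatrix id fun i => (e₁ i : Fin m) with hV
  set W := U.submatrix id fun i => (e₂ i : Fin m) with hW
  have hVW : fromCols V W = U.submatrix id e := by
    ext a (b | b) <;> rfl
  have h1 : (fromCols V W)ᴴ * fromCols V W = 1 := by
    rw [hVW, conjTranspose_submatrix, ← submatrix_mul _ _ _ _ _ Function.bijective_id, hU,
      submatrix_one_equiv]
  have h2 : fromCols V W * (fromCols V W)ᴴ = 1 := by
    rw [hVW, conjTranspose_submatrix, submatrix_mul_equiv, hU', submatrix_id_id]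
  rw [conjTranspose_fromCols_eq_fromRows_conjTranspose] at h1 h2
  rw [fromCols_mul_fromRows] at h2
  rw [fromRows_mul_fromCols, ← fromBlocks_one, fromBlocks_inj] at h1
  refine ⟨_, _, V, W, ?_, ?_, h1.1, h1.2.2.2, h2, fun j => ?_, fun j => ?_⟩
  · simpa using Fintype.card_subtype_lt (p := fun i => h i = h i₀) (x := i₁) (Ne.symm hi)
  · simpa using Fintype.card_subtype_lt (p := fun i => ¬ h i = h i₀) (x := i₀) (by simp)
  · ext a b
    exact hoff j _ _ fun hab => (e₂ b).2 (hab.symm.trans (e₁ a).2)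
  · ext a b
    exact hoff j _ _ fun hab => (e₂ a).2 (hab.trans (e₁ b).2)

lemma Arveson.absHull_fin (m : ℕ) : ∀ {Z : Fin g → Matrix (Fin m) (Fin m) ℂ}, InSpec A Z →
    Arveson A Z → AbsHull A Z := by
  induction m using Nat.strong_induction_on with
  | _ m ih =>
    intro Z hZ hZA
    by_cases hirr : ∀ H : Matrix (Fin m) (Fin m) ℂ, H.IsHermitian → (∀ j, H * Z j = Z j * H) →
      ∃ c : ℂ, H = c • (1 : Matrix (Fin m) (Fin m) ℂ)
    · exact absHull_of_isAbsExt (isAbsExt_of_arveson hZ hZA hirr)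
    push Not at hirr
    obtain ⟨H, hH, hHZ, hne⟩ := hirr
    obtain ⟨p, q, V, W, hp, hq, hV, hW, hVW, h1, h2⟩ := exists_split hH hHZ hne
    have e1 : ∀ j, Vᴴ * Z j = Vᴴ * Z j * V * Vᴴ := fun j => by
      have := congrArg (Vᴴ * Z j * ·) hVW
      simp only [Matrix.mul_add, Matrix.mul_one, ← Matrix.mul_assoc, h1] at this
      simpa using this.symm
    have e2 : ∀ j, Wᴴ * Z j = Wᴴ * Z j * W * Wᴴ := fun j => by
      have := congrArg (Wᴴ * Z j * ·) hVW
      simp only [Matrix.mul_add, Matrix.mul_one, ← Matrix.mul_assoc, h2] at this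
      simpa using this.symm
    have h3 := AbsHull.comb_two (V := Vᴴ) (W := Wᴴ) (by simpa using hVW)
      (ih p hp (hZ.compress_s1 hV) (hZA.of_intertwine hV e1))
      (ih q hq (hZ.compress_s1 hW) (hZA.of_intertwine hW e2))
    convert h3 using 1
    funext j
    rw [Matrix.mul_assoc _ _ Vᴴ, Matrix.mul_assoc _ _ Wᴴ, ← e1, ← e2, conjTranspose_conjTranspose,
      conjTranspose_conjTranspose, ← Matrix.mul_assoc, ← Matrix.mul_assoc, ← Matrix.add_mul, hVW,
      Matrix.one_mul]

lemma AbsHull.exists_fin {X : Fin g → Matrix ι ι ℂ} (hX : AbsHull A X) :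
    ∃ (k : ℕ) (nn : Fin k → ℕ) (Y : ∀ i, Fin g → Matrix (Fin (nn i)) (Fin (nn i)) ℂ)
      (V : ∀ i, Matrix (Fin (nn i)) ι ℂ),
      (∀ i, IsAbsExt (fun ℓ => {W : Fin g → Matrix (Fin ℓ) (Fin ℓ) ℂ | InSpec A W}) (Y i)) ∧
      (∑ i, (V i)ᴴ * V i = 1) ∧ ∀ j, X j = ∑ i, (V i)ᴴ * Y i j * V i := by
  obtain ⟨s, hs, ℓ, Y, V, hY, h1, h2⟩ := hX
  set e := (Fintype.equivFin s).symm
  refine ⟨_, fun i => ℓ (e i), fun i => Y (e i), fun i => V (e i), fun i => hY _, ?_, fun j => ?_⟩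
  · rw [← h1]
    exact e.sum_comp fun i => (V i)ᴴ * V i
  · rw [h2]
    exact (e.sum_comp fun i => (V i)ᴴ * Y i j * V i).symm

end Hull

lemma Arveson.absHull {g d : ℕ} {κ : Type} [Fintype κ] [DecidableEq κ]
    {A : Fin g → Matrix (Fin d) (Fin d) ℂ} {Z : Fin g → Matrix κ κ ℂ} (hZ : InSpec A Z)
    (hZA : Arveson A Z) : AbsHull A Z := by
  set e := (Fintype.equivFin κ).symm
  set P : Matrix κ (Fin (Fintype.card κ)) ℂ := (1 : Matrix κ κ ℂ).submatrix id e with hP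
  have h1 : Pᴴ * P = 1 := by
    ext a b
    simp [hP, Matrix.mul_apply, one_apply]
  have h2 : P * Pᴴ = 1 := (mul_eq_one_comm_of_card_eq _ _ _ (by simp)).1 h1
  have h3 := (Arveson.absHull_fin _ (hZ.compress_s1 h1) (hZA.of_intertwine h1 fun j => by
    rw [Matrix.mul_assoc _ P, h2, Matrix.mul_one])).compress_s1 (V := Pᴴ) (by simpa using h2)
  convert h3 using 1
  funext j
  rw [conjTranspose_conjTranspose, ← Matrix.mul_assoc, ← Matrix.mul_assoc, h2, Matrix.one_mul,
    Matrix.mul_assoc, h2, Matrix.mul_one]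

end FreeSpectrahedron
/-- A compact complex free spectrahedron which is closed under complex
conjugation is the matrix convex hull of its absolute extreme points. -/
theorem complexSpectrahedron_matrixConvexHull_absExtremePoints
    {g d : ℕ} (hg : 0 < g) (hd : 0 < d)
    (A : Fin g → Matrix (Fin d) (Fin d) ℂ) (hA : SATuple A)
    (hbdd : ∃ C : ℝ, 0 < C ∧ ∀ (m : ℕ) (X : Fin g → Matrix (Fin m) (Fin m) ℂ),
      InSpec A X → ((C : ℂ) • (1 : Matrix (Fin m) (Fin m) ℂ) - ∑ j, X j * X j).PosSemidef)
    (hclosed : ∀ m : ℕ, IsClosed {X : Fin g → Matrix (Fin m) (Fin m) ℂ | InSpec A X})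
    (hconj : ∀ (m : ℕ) (X : Fin g → Matrix (Fin m) (Fin m) ℂ),
      InSpec A X → InSpec A fun j => (X j).map (starRingEnd ℂ)) :
    ∀ (n : ℕ) (X : Fin g → Matrix (Fin n) (Fin n) ℂ),
      InSpec A X ↔
        ∃ (k : ℕ) (nn : Fin k → ℕ)
          (Y : ∀ i, Fin g → Matrix (Fin (nn i)) (Fin (nn i)) ℂ)
          (V : ∀ i, Matrix (Fin (nn i)) (Fin n) ℂ),
          (∀ i, IsAbsExt (fun ℓ => {W : Fin g → Matrix (Fin ℓ) (Fin ℓ) ℂ | InSpec A W}) (Y i)) ∧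
          (∑ i, (V i)ᴴ * V i = 1) ∧ ∀ j, X j = ∑ i, (V i)ᴴ * Y i j * V i := by
  intro n X
  constructor
  · intro hX
    obtain ⟨R, V, hR, hRr, hV, hVX⟩ := hX.exists_real hconj
    obtain ⟨κ, _, _, Z, W, hZ, hZr, hZ0, hW, hWR⟩ :=
      FreeSpectrahedron.exists_real_dilation hA hbdd hclosed _ _ R hR hRr le_rfl
    have hZA := FreeSpectrahedron.arveson_of_realDir_eq_bot hA hconj hZ hZr hZ0
    have h := ((FreeSpectrahedron.Arveson.absHull hZ hZA).compress_s1 hW).compress_s1 hV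
    simp only [hWR, hVX] at h
    exact h.exists_fin
  · rintro ⟨k, nn, Y, V, hY, hV, hX⟩
    exact FreeSpectrahedron.IsComb.inSpec (Y := Y) (V := V) ⟨hV, hX⟩ fun i => (hY i).1
end
end

section
/- Let A be a g-tuple of d×d real symmetric matrices and let X be a g-tuple of n×n real symmetric matrices, regarded as a tuple of complex self-adjoint matrices lying in D_A^ℂ. Then X is an Arveson extreme point of the complex free spectrahedron D_A^ℂ if and only if X is an Arveson extreme point of the real free spectrahedron D_A^ℝ. -/
open Matrix
open scoped Kronecker ComplexOrder

noncomputable section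

variable {𝕜 : Type*} [RCLike 𝕜]

/-- `X` is an Arveson extreme point of `D_A`: every dilation of `X` inside `D_A` is trivial. -/
def IsArvExt {g d : ℕ} {m : Type*} [Fintype m] [DecidableEq m]
    (A : Fin g → Matrix (Fin d) (Fin d) 𝕜) (X : Fin g → Matrix m m 𝕜) : Prop :=
  InSpec A X ∧
  ∀ (ℓ : ℕ) (β : Fin g → Matrix m (Fin ℓ) 𝕜) (γ : Fin g → Matrix (Fin ℓ) (Fin ℓ) 𝕜),
    InSpec A (fun j => Matrix.fromBlocks (X j) (β j) (β j)ᴴ (γ j)) → β = 0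

/-- The entrywise real part of a complex positive semidefinite matrix is positive semidefinite. -/
theorem Matrix.PosSemidef.map_re {m : Type*} [Fintype m] {M : Matrix m m ℂ}
    (hM : M.PosSemidef) : (M.map Complex.re).PosSemidef := by
  refine .of_dotProduct_mulVec_nonneg ?_ fun x => ?_
  · ext i j
    have := congrArg Complex.re (hM.1.apply i j)
    simpa using this
  · have := (Complex.le_def.1 (hM.dotProduct_mulVec_nonneg fun i => (x i : ℂ))).1
    simpa [dotProduct, mulVec] using this

open scoped MatrixOrder in
/-- A real positive semidefinite matrix stays positive semidefinite over `ℂ`. -/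
theorem Matrix.PosSemidef.map_ofReal {m : Type*} [Fintype m] {M : Matrix m m ℝ}
    (hM : M.PosSemidef) : (M.map (Complex.ofReal : ℝ → ℂ)).PosSemidef := by
  classical
  obtain ⟨B, rfl⟩ := CStarAlgebra.nonneg_iff_eq_star_mul_self.mp hM.nonneg
  rw [star_eq_conjTranspose]
  have h : (Bᴴ * B).map (Complex.ofReal : ℝ → ℂ) =
      (B.map (Complex.ofReal : ℝ → ℂ))ᴴ * B.map (Complex.ofReal : ℝ → ℂ) := by
    ext i j
    simp [mul_apply]
  rw [h]
  exact posSemidef_conjTranspose_mul_self _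

theorem Lam_map_re {g d : ℕ} {p q : Type*} (A : Fin g → Matrix (Fin d) (Fin d) ℝ)
    (B : Fin g → Matrix p q ℂ) :
    (Lam (fun j => (A j).map (Complex.ofReal : ℝ → ℂ)) B).map Complex.re =
      Lam A fun j => (B j).map Complex.re := by
  ext i j
  simp [Lam, Matrix.sum_apply]

theorem LPencil_map_ofReal {g d : ℕ} {m : Type*} [Fintype m] [DecidableEq m]
    (A : Fin g → Matrix (Fin d) (Fin d) ℝ) (X : Fin g → Matrix m m ℝ) :
    LPencil (fun j => (A j).map (Complex.ofReal : ℝ → ℂ))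
        (fun j => (X j).map (Complex.ofReal : ℝ → ℂ)) =
      (LPencil A X).map (Complex.ofReal : ℝ → ℂ) := by
  ext i j
  simp [LPencil, Lam, Matrix.sum_apply, Matrix.one_apply, apply_ite (Complex.ofReal : ℝ → ℂ)]

theorem InSpec.map_ofReal {g d : ℕ} {m : Type*} [Fintype m] [DecidableEq m]
    {A : Fin g → Matrix (Fin d) (Fin d) ℝ} {X : Fin g → Matrix m m ℝ} (h : InSpec A X) :
    InSpec (fun j => (A j).map (Complex.ofReal : ℝ → ℂ))
      (fun j => (X j).map (Complex.ofReal : ℝ → ℂ)) := by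
  refine ⟨fun j => ?_, LPencil_map_ofReal A X ▸ h.2.map_ofReal⟩
  ext a b
  simpa using (h.1 j).apply a b

theorem Lam_conjTranspose_mul_mul {g d : ℕ} {p q : Type*} [Fintype p]
    (A : Fin g → Matrix (Fin d) (Fin d) 𝕜) (Y : Fin g → Matrix p p 𝕜) (P : Matrix p q 𝕜) :
    Lam A (fun j => Pᴴ * Y j * P) =
      ((1 : Matrix (Fin d) (Fin d) 𝕜) ⊗ₖ P)ᴴ * Lam A Y *
        ((1 : Matrix (Fin d) (Fin d) 𝕜) ⊗ₖ P) := by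
  simp [Lam, conjTranspose_kronecker, Matrix.mul_sum, Matrix.sum_mul, ← mul_kronecker_mul]

/-- If `Re (Pᴴ P) = 1`, then `Y ↦ Re (Pᴴ Y P)` maps `D_A^ℂ` to `D_A^ℝ`. -/
theorem InSpec.re_compression {g d : ℕ} {p q : Type*} [Fintype p] [DecidableEq p]
    [Fintype q] [DecidableEq q] {A : Fin g → Matrix (Fin d) (Fin d) ℝ}
    {Y : Fin g → Matrix p p ℂ} (h : InSpec (fun j => (A j).map (Complex.ofReal : ℝ → ℂ)) Y)
    (P : Matrix p q ℂ) (hP : (Pᴴ * P).map Complex.re = 1) :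
    InSpec A fun j => (Pᴴ * Y j * P).map Complex.re := by
  refine ⟨fun j => ?_, ?_⟩
  · ext a b
    have := congrArg Complex.re ((isHermitian_conjTranspose_mul_mul P (h.1 j)).apply a b)
    simpa using this
  · have key := (h.2.conjTranspose_mul_mul_same
      ((1 : Matrix (Fin d) (Fin d) ℂ) ⊗ₖ P)).map_re
    have hone : ((1 : Matrix (Fin d) (Fin d) ℂ) ⊗ₖ (Pᴴ * P)).map Complex.re = 1 := by
      rw [← one_kronecker_one, ← hP]
      ext i j
      by_cases hij : i.1 = j.1 <;> simp [Matrix.one_apply, hij]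
    rw [LPencil, Matrix.mul_add, Matrix.add_mul, ← Lam_conjTranspose_mul_mul, Matrix.mul_one,
      conjTranspose_kronecker, ← mul_kronecker_mul, conjTranspose_one, Matrix.mul_one,
      Matrix.map_add _ Complex.add_re, Lam_map_re, hone] at key
    exact key

/-- The row `[1, i]`, used to turn a complex space of dimension `ℓ` into a real one of
dimension `ℓ + ℓ`. -/
def realifier (ℓ : ℕ) : Matrix (Fin ℓ) (Fin (ℓ + ℓ)) ℂ :=
  (fromCols 1 (Complex.I • (1 : Matrix (Fin ℓ) (Fin ℓ) ℂ))).submatrix id finSumFinEquiv.symm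

theorem mul_realifier {m : Type*} {ℓ : ℕ} (β : Matrix m (Fin ℓ) ℂ) :
    β * realifier ℓ = (fromCols β (Complex.I • β)).submatrix id finSumFinEquiv.symm := by
  rw [realifier, ← Matrix.submatrix_id_id β, ← submatrix_mul _ _ _ _ _ Function.bijective_id,
    mul_fromCols]
  simp

theorem realifier_conjTranspose_mul_self_map_re (ℓ : ℕ) :
    ((realifier ℓ)ᴴ * realifier ℓ).map Complex.re = 1 := by
  rw [mul_realifier]
  ext i j
  obtain ⟨i, rfl⟩ := finSumFinEquiv.surjective i
  obtain ⟨j, rfl⟩ := finSumFinEquiv.surjective j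
  rcases i with i | i <;> rcases j with j | j <;>
    rw [map_apply, submatrix_apply, Equiv.symm_apply_apply] <;>
    simp [realifier, Matrix.one_apply, eq_comm, apply_ite Complex.re, -finSumFinEquiv_apply_left,
      -finSumFinEquiv_apply_right, apply_ite (starRingEnd ℂ)]

theorem eq_zero_of_mul_realifier_map_re {m : Type*} {ℓ : ℕ} {β : Matrix m (Fin ℓ) ℂ}
    (h : (β * realifier ℓ).map Complex.re = 0) : β = 0 := by
  rw [mul_realifier] at h
  ext a b
  have h1 := congrFun (congrFun h a) (finSumFinEquiv (.inl b))
  have h2 := congrFun (congrFun h a) (finSumFinEquiv (.inr b))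
  apply Complex.ext
  · simpa [-finSumFinEquiv_apply_left] using h1
  · simpa [-finSumFinEquiv_apply_right] using h2

/-- For a tuple `A` of real symmetric matrices and a tuple `X` of real
symmetric matrices in `D_A^ℂ`, `X` is an Arveson extreme point of `D_A^ℂ` iff `X` is an
Arveson extreme point of `D_A^ℝ`. -/
theorem real_arvesonExtreme_iff_complex_arvesonExtreme
    {g d n : ℕ} (A : Fin g → Matrix (Fin d) (Fin d) ℝ) (hA : SATuple A)
    (X : Fin g → Matrix (Fin n) (Fin n) ℝ)
    (hX : InSpec (fun j => (A j).map (Complex.ofReal : ℝ → ℂ))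
      (fun j => (X j).map (Complex.ofReal : ℝ → ℂ))) :
    IsArvExt (fun j => (A j).map (Complex.ofReal : ℝ → ℂ))
        (fun j => (X j).map (Complex.ofReal : ℝ → ℂ)) ↔
      IsArvExt A X := by
  have hXr : InSpec A X := by
    have h := hX.re_compression (1 : Matrix (Fin n) (Fin n) ℂ) (by
      rw [conjTranspose_one, Matrix.one_mul]
      exact Matrix.map_one _ Complex.zero_re Complex.one_re)
    simpa [Function.comp_def] using h
  refine ⟨fun h => ⟨hXr, fun ℓ β γ hβ => ?_⟩, fun h => ⟨hX, fun ℓ β γ hβ => ?_⟩⟩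
  · have h0 := h.2 ℓ (fun j => (β j).map (Complex.ofReal : ℝ → ℂ))
      (fun j => (γ j).map (Complex.ofReal : ℝ → ℂ)) (by
        convert hβ.map_ofReal using 2 with j
        rw [fromBlocks_map]
        congr 1
        ext a b
        simp)
    funext j
    ext a b
    simpa using congrFun (congrFun (congrFun h0 j) a) b
  · have hc := hβ.re_compression
      (fromBlocks (1 : Matrix (Fin n) (Fin n) ℂ) 0 0 (realifier ℓ)) (by
      have hone : (1 : Matrix (Fin n) (Fin n) ℂ).map Complex.re = 1 :=
        Matrix.map_one _ Complex.zero_re Complex.one_re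
      rw [fromBlocks_conjTranspose, fromBlocks_multiply, fromBlocks_map]
      simp [realifier_conjTranspose_mul_self_map_re, hone])
    have h0 := h.2 (ℓ + ℓ) (fun j => (β j * realifier ℓ).map Complex.re)
      (fun j => ((realifier ℓ)ᴴ * γ j * realifier ℓ).map Complex.re) (by
        convert hc using 2 with j
        simp only [fromBlocks_conjTranspose, fromBlocks_multiply, fromBlocks_map]
        congr 1
        · ext a b
          simp
        · ext a b
          simp
        · rw [conjTranspose_zero]
          simp only [Matrix.zero_mul, Matrix.mul_zero, zero_add, add_zero, Matrix.mul_one,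
            ← conjTranspose_mul]
          ext a b
          simp [-conjTranspose_mul]
        · simp)
    funext j
    exact eq_zero_of_mul_realifier_map_re (congrFun h0 j)
end
end

section
/- Let A be a g-tuple of d×d complex self-adjoint matrices. Then the complex free spectrahedron D_A^ℂ is closed under complex conjugation if and only if there exists a g-tuple B of real symmetric matrices of size at most 2d×2d such that D_A^ℂ = D_B^ℂ. -/
open Matrix
open scoped Kronecker ComplexOrder

noncomputable section

variable {𝕜 : Type*} [RCLike 𝕜]

/-- Compressing a pencil by `V ⊗ 1` and `W ⊗ 1` compresses its coefficients. -/
theorem kronecker_one_mul_LPencil_mul {g d e : ℕ} {m : Type*} [Fintype m] [DecidableEq m]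
    (C : Fin g → Matrix (Fin e) (Fin e) 𝕜) (X : Fin g → Matrix m m 𝕜)
    (V : Matrix (Fin d) (Fin e) 𝕜) (W : Matrix (Fin e) (Fin d) 𝕜) :
    (V ⊗ₖ (1 : Matrix m m 𝕜)) * LPencil C X * (W ⊗ₖ (1 : Matrix m m 𝕜)) =
      (V * W) ⊗ₖ (1 : Matrix m m 𝕜) + Lam (fun j => V * C j * W) X := by
  simp only [LPencil, Lam, Matrix.mul_add, Matrix.add_mul, Matrix.mul_one, Matrix.mul_sum,
    Matrix.sum_mul, ← Matrix.mul_kronecker_mul, Matrix.one_mul]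

/-- Entrywise conjugation of both the coefficients and the point preserves membership in a
free spectrahedron. -/
theorem InSpec.map_conj {g d : ℕ} {m : Type*} [Fintype m] [DecidableEq m]
    {A : Fin g → Matrix (Fin d) (Fin d) 𝕜} {X : Fin g → Matrix m m 𝕜} (h : InSpec A X) :
    InSpec (fun j => (A j).map (starRingEnd 𝕜)) (fun j => (X j).map (starRingEnd 𝕜)) := by
  refine ⟨fun j => (h.1 j).map _ fun _ => rfl, ?_⟩
  have hconj : LPencil (fun j => (A j).map (starRingEnd 𝕜)) (fun j => (X j).map (starRingEnd 𝕜)) =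
      (LPencil A X)ᴴᵀ := by
    simp only [LPencil, Lam, conjTranspose_add, conjTranspose_sum, transpose_add, transpose_sum,
      conjTranspose_one, transpose_one]
    congr! 2
    ext
    simp
  exact hconj ▸ h.2.conjTranspose.transpose

/-- The real `2d × 2d` matrix representing the complex matrix `M`. -/
def realification {d : ℕ} (M : Matrix (Fin d) (Fin d) ℂ) :
    Matrix (Fin d ⊕ Fin d) (Fin d ⊕ Fin d) ℝ :=
  fromBlocks (M.map Complex.re) (-M.map Complex.im) (M.map Complex.im) (M.map Complex.re)

theorem realification_isSymm {d : ℕ} {M : Matrix (Fin d) (Fin d) ℂ} (hM : M.IsHermitian) :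
    (realification M).IsSymm := by
  have hre : (M.map Complex.re)ᵀ = M.map Complex.re := by
    ext a b
    simpa using congrArg Complex.re (hM.apply a b)
  have him : (M.map Complex.im)ᵀ = -M.map Complex.im := by
    ext a b
    simpa [neg_eq_iff_eq_neg] using congrArg Complex.im (hM.apply a b)
  simp [Matrix.IsSymm, realification, fromBlocks_transpose, hre, him]

/-- The matrix `(1, s)ᵀ`; for `s = ∓i` its range is an invariant subspace of every
realification. -/
def stackedScalar (d : ℕ) (s : ℂ) : Matrix (Fin d ⊕ Fin d) (Fin d) ℂ :=
  fromRows 1 (s • 1)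

theorem stackedScalar_conjTranspose_mul_self (d : ℕ) :
    (stackedScalar d (-Complex.I))ᴴ * stackedScalar d (-Complex.I) = (2 : ℂ) • 1 := by
  simp [stackedScalar, conjTranspose_fromRows_eq_fromCols_conjTranspose, fromCols_mul_fromRows,
    smul_smul, two_smul]

theorem stackedScalar_mul_conjTranspose_add (d : ℕ) :
    stackedScalar d (-Complex.I) * (stackedScalar d (-Complex.I))ᴴ +
      stackedScalar d Complex.I * (stackedScalar d Complex.I)ᴴ = (2 : ℂ) • 1 := by
  simp only [stackedScalar, conjTranspose_fromRows_eq_fromCols_conjTranspose,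
    fromRows_mul_fromCols, fromBlocks_add, two_smul]
  simp [smul_smul, ← fromBlocks_one, fromBlocks_add]

theorem realification_mul_stackedScalar_neg_I {d : ℕ} (M : Matrix (Fin d) (Fin d) ℂ) :
    (realification M).map (Complex.ofReal : ℝ → ℂ) * stackedScalar d (-Complex.I) =
      stackedScalar d (-Complex.I) * M := by
  ext (a | a) b <;>
  simp [realification, stackedScalar, fromBlocks_map, fromBlocks_mul_fromRows, fromRows_mul,
    Complex.ext_iff]

theorem realification_mul_stackedScalar_I {d : ℕ} (M : Matrix (Fin d) (Fin d) ℂ) :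
    (realification M).map (Complex.ofReal : ℝ → ℂ) * stackedScalar d Complex.I =
      stackedScalar d Complex.I * M.map (starRingEnd ℂ) := by
  ext (a | a) b <;>
  simp [realification, stackedScalar, fromBlocks_map, fromBlocks_mul_fromRows, fromRows_mul,
    Complex.ext_iff]

/-- The free spectrahedron of the realified tuple is contained in that of the original tuple. -/
theorem InSpec.of_realification {g d e : ℕ} {m : Type*} [Fintype m] [DecidableEq m]
    (f : Fin e ≃ Fin d ⊕ Fin d) {A : Fin g → Matrix (Fin d) (Fin d) ℂ} {X : Fin g → Matrix m m ℂ}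
    (h : InSpec (fun j => ((realification (A j)).submatrix f f).map (Complex.ofReal : ℝ → ℂ)) X) :
    InSpec A X := by
  refine ⟨h.1, ?_⟩
  set V := (stackedScalar d (-Complex.I)).submatrix f id with hV
  have hVV : Vᴴ * V = (2 : ℂ) • 1 := by
    rw [hV, conjTranspose_submatrix, submatrix_mul_equiv, stackedScalar_conjTranspose_mul_self,
      submatrix_id_id]
  have hVA : ∀ j, Vᴴ * ((realification (A j)).submatrix f f).map (Complex.ofReal : ℝ → ℂ) * V =
      (2 : ℂ) • A j := fun j => by
    rw [Matrix.mul_assoc, ← submatrix_map, hV, submatrix_mul_equiv,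
      realification_mul_stackedScalar_neg_I, conjTranspose_submatrix, submatrix_mul_equiv,
      ← Matrix.mul_assoc, stackedScalar_conjTranspose_mul_self, submatrix_id_id,
      Matrix.smul_mul, Matrix.one_mul]
  have key := h.2.conjTranspose_mul_mul_same (V ⊗ₖ (1 : Matrix m m ℂ))
  rw [conjTranspose_kronecker, conjTranspose_one, kronecker_one_mul_LPencil_mul, hVV] at key
  simp only [hVA] at key
  convert key.smul (show (0 : ℂ) ≤ 2⁻¹ by simp) using 2
  simp [LPencil, Lam, smul_kronecker, ← Finset.smul_sum, smul_smul]

/-- The free spectrahedron of the realified tuple contains the intersection of the free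
spectrahedra of the original tuple and of its entrywise conjugate. -/
theorem InSpec.realification_of_conj {g d e : ℕ} {m : Type*} [Fintype m] [DecidableEq m]
    (f : Fin e ≃ Fin d ⊕ Fin d) {A : Fin g → Matrix (Fin d) (Fin d) ℂ} {X : Fin g → Matrix m m ℂ}
    (h : InSpec A X) (h' : InSpec (fun j => (A j).map (starRingEnd ℂ)) X) :
    InSpec (fun j => ((realification (A j)).submatrix f f).map (Complex.ofReal : ℝ → ℂ)) X := by
  refine ⟨h.1, ?_⟩
  set V := (stackedScalar d (-Complex.I)).submatrix f id with hV
  set W := (stackedScalar d Complex.I).submatrix f id with hW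
  have hone : V * Vᴴ + W * Wᴴ = (2 : ℂ) • 1 := by
    rw [← submatrix_one_equiv f]
    exact congrArg (fun M => M.submatrix f f) (stackedScalar_mul_conjTranspose_add d)
  have hcoeff : ∀ j, V * A j * Vᴴ + W * (A j).map (starRingEnd ℂ) * Wᴴ =
      (2 : ℂ) • ((realification (A j)).submatrix f f).map (Complex.ofReal : ℝ → ℂ) := by
    intro j
    have hVj : V * A j = ((realification (A j)).submatrix f f).map
        (Complex.ofReal : ℝ → ℂ) * V := by
      rw [← submatrix_map, hV, submatrix_mul_equiv, realification_mul_stackedScalar_neg_I]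
      rfl
    have hWj : W * (A j).map (starRingEnd ℂ) = ((realification (A j)).submatrix f f).map
        (Complex.ofReal : ℝ → ℂ) * W := by
      rw [← submatrix_map, hW, submatrix_mul_equiv, realification_mul_stackedScalar_I]
      rfl
    rw [hVj, hWj, Matrix.mul_assoc, Matrix.mul_assoc, ← Matrix.mul_add, hone, Matrix.mul_smul,
      Matrix.mul_one]
  have key := (h.2.mul_mul_conjTranspose_same (V ⊗ₖ (1 : Matrix m m ℂ))).add
    (h'.2.mul_mul_conjTranspose_same (W ⊗ₖ (1 : Matrix m m ℂ)))
  rw [conjTranspose_kronecker, conjTranspose_kronecker, conjTranspose_one,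
    kronecker_one_mul_LPencil_mul, kronecker_one_mul_LPencil_mul, add_add_add_comm,
    ← add_kronecker, hone, Lam, Lam, ← Finset.sum_add_distrib] at key
  simp only [← add_kronecker, hcoeff] at key
  convert key.smul (show (0 : ℂ) ≤ 2⁻¹ by simp) using 2
  simp [LPencil, Lam, smul_kronecker, ← Finset.smul_sum, smul_smul]

/-- A complex free spectrahedron `D_A^ℂ` is closed under complex
conjugation iff `D_A^ℂ = D_B^ℂ` for some tuple `B` of real symmetric matrices of size at
most `2d × 2d`. -/
theorem closed_under_conjugation_iff_real_pencil
    {g d : ℕ} (A : Fin g → Matrix (Fin d) (Fin d) ℂ) (hA : SATuple A) :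
    (∀ (n : ℕ) (X : Fin g → Matrix (Fin n) (Fin n) ℂ),
      InSpec A X → InSpec A fun j => (X j).map (starRingEnd ℂ)) ↔
      ∃ (e : ℕ), e ≤ 2 * d ∧ ∃ B : Fin g → Matrix (Fin e) (Fin e) ℝ,
        (∀ j, (B j).IsSymm) ∧
        ∀ (n : ℕ) (X : Fin g → Matrix (Fin n) (Fin n) ℂ),
          InSpec A X ↔ InSpec (fun j => (B j).map (Complex.ofReal : ℝ → ℂ)) X := by
  constructor
  · intro h
    let f : Fin (2 * d) ≃ Fin d ⊕ Fin d := (finCongr (two_mul d)).trans finSumFinEquiv.symm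
    refine ⟨2 * d, le_rfl, fun j => (realification (A j)).submatrix f f,
      fun j => (realification_isSymm (hA j)).submatrix f,
      fun n X => ⟨fun hX => hX.realification_of_conj f ?_, InSpec.of_realification f⟩⟩
    simpa [Matrix.map_map, Function.comp_def] using (h n X hX).map_conj
  · rintro ⟨e, -, B, -, hB⟩ n X hX
    rw [hB] at hX ⊢
    simpa [Matrix.map_map, Function.comp_def] using hX.map_conj
end
end

section
/- Let K = ℝ or ℂ, let A ∈ SM_d(K)^g, let X ∈ SM_n(K)^g, let β ∈ M_{n×1}(K)^g, and let c ∈ ℝ. Then the block tuple Y_0 = ((X, cβ), (cβ^*, 0)), whose j-th entry is the (n+1)×(n+1) matrix [[X_j, c·β_j],[c·β_j^*, 0]], satisfies L_A(Y_0) ⪰ 0 if and only if L_A(X) − c²·Λ_A(β)Λ_A(β^*) ⪰ 0, where Λ_A(β) = Σ_j A_j ⊗ β_j ∈ M_{dn×d}(K) and Λ_A(β^*) = Σ_j A_j ⊗ β_j^* ∈ M_{d×dn}(K). -/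
open Matrix
open scoped Kronecker ComplexOrder

noncomputable section

variable {𝕜 : Type*} [RCLike 𝕜]

/-- The pencil respects adjoints when its coefficients are self-adjoint. -/
theorem Lam_conjTranspose {g d : ℕ} {p q : Type*} {A : Fin g → Matrix (Fin d) (Fin d) 𝕜}
    (hA : SATuple A) (B : Fin g → Matrix p q 𝕜) :
    (Lam A B)ᴴ = Lam A fun j => (B j)ᴴ := by
  simp only [Lam, conjTranspose_sum, conjTranspose_kronecker, (hA _).eq]

theorem Lam_smul {g d : ℕ} {p q : Type*} (A : Fin g → Matrix (Fin d) (Fin d) 𝕜) (c : 𝕜)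
    (B : Fin g → Matrix p q 𝕜) : (Lam A fun j => c • B j) = c • Lam A B := by
  simp only [Lam, kronecker_smul, Finset.smul_sum]

/-- The pencil of a block tuple is, up to the canonical shuffle, the block matrix of pencils. -/
theorem LPencil_fromBlocks_submatrix {g d : ℕ} {p q : Type*} [Fintype p] [DecidableEq p]
    [Fintype q] [DecidableEq q] (A : Fin g → Matrix (Fin d) (Fin d) 𝕜)
    (X : Fin g → Matrix p p 𝕜) (B : Fin g → Matrix p q 𝕜) (C : Fin g → Matrix q p 𝕜)
    (D : Fin g → Matrix q q 𝕜) :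
    (LPencil A fun j => fromBlocks (X j) (B j) (C j) (D j)).submatrix
        (Equiv.prodSumDistrib (Fin d) p q).symm (Equiv.prodSumDistrib (Fin d) p q).symm =
      fromBlocks (LPencil A X) (Lam A B) (Lam A C) (LPencil A D) := by
  ext (⟨a, i⟩ | ⟨a, i⟩) (⟨b, k⟩ | ⟨b, k⟩) <;>
    simp [LPencil, Lam, Matrix.sum_apply, Matrix.one_apply]

/-- Schur complement criterion: `L_A(((X, cβ), (cβ^*, 0))) ⪰ 0` iff
`L_A(X) − c² Λ_A(β) Λ_A(β^*) ⪰ 0`. -/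
theorem pencil_dilation_zero_corner_psd_iff_schur
    {g d n : ℕ} (A : Fin g → Matrix (Fin d) (Fin d) 𝕜) (hA : SATuple A)
    (X : Fin g → Matrix (Fin n) (Fin n) 𝕜) (hXsa : SATuple X)
    (β : Fin g → Matrix (Fin n) (Fin 1) 𝕜) (c : ℝ) :
    (LPencil A fun j => Matrix.fromBlocks (X j) ((c : 𝕜) • β j) ((c : 𝕜) • β j)ᴴ
        (0 : Matrix (Fin 1) (Fin 1) 𝕜)).PosSemidef ↔
      (LPencil A X - ((c : 𝕜) ^ 2) • (Lam A β * Lam A fun j => (β j)ᴴ)).PosSemidef := by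
  rw [← posSemidef_submatrix_equiv (Equiv.prodSumDistrib (Fin d) (Fin n) (Fin 1)).symm,
    LPencil_fromBlocks_submatrix, ← Lam_conjTranspose hA]
  have hD : (LPencil A fun _ => (0 : Matrix (Fin 1) (Fin 1) 𝕜)) = 1 := by simp [LPencil, Lam]
  let : Invertible (1 : Matrix (Fin d × Fin 1) (Fin d × Fin 1) 𝕜) := invertibleOne
  rw [hD, PosDef.one.fromBlocks₂₂, ← Lam_conjTranspose hA, Lam_smul]
  simp only [inv_one, Matrix.mul_one, conjTranspose_smul, RCLike.star_def, RCLike.conj_ofReal,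
    Matrix.smul_mul, Matrix.mul_smul, smul_smul, pow_two]
end
end
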